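/- Let J be a real analytic almost complex structure on a neighborhood of 0 in ℝ^{2n} with J(0) = J₀ and M = {φ = 0} with 0 ∈ M. Let L₁,…,L_ℓ be real analytic vector fields near 0 lying in T^JM such that at every point q the vectors L₁(q),…,L_ℓ(q), J(q)L₁(q),…,J(q)L_ℓ(q) are linearly independent over ℝ; call a vector field of the form X = ∑_{p=1}^ℓ (a_p + b_p J)L_p, with a_p, b_p real analytic real-valued functions, a section of the subbundle 𝕃, and set 𝕃₀ = span_ℝ{L₁(0),…,L_ℓ(0), J(0)L₁(0),…,J(0)L_ℓ(0)}. Assume: whenever a section X of 𝕃 commutes at order k at 0, then for all X₁,…,X_{k+1} ∈ {X, JX}, the vector [X₁,[…,[X_k,X_{k+1}]…]](0) belongs to 𝕃₀. Then for every section X of 𝕃 there exist ρ > 0 and a real analytic J-holomorphic map γ : {ζ ∈ ℂ : |ζ| < ρ} → ℝ^{2n} with γ(0) = 0, γ({|ζ| < ρ}) ⊆ M, and ∂^kγ/∂x^k(0) = D_X^{k−1,0}X(0) for all k ≥ 1. -/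

import Mathlib

noncomputable section

open Metric

/-- `ℝ^{2n}` identified with `ℂ^n`. -/
abbrev Ecx (n : ℕ) := EuclideanSpace ℂ (Fin n)

/-- The standard complex structure `J₀` (multiplication by `i`), as a real-linear map. -/
def J0 (n : ℕ) : Ecx n →L[ℝ] Ecx n := Complex.I • ContinuousLinearMap.id ℝ (Ecx n)

variable {F : Type*} [NormedAddCommGroup F] [NormedSpace ℝ F]

/-- `J`-holomorphy of `γ` on a set `D ⊆ ℂ`: `dγ(ζ) ∘ J_st = J(γ ζ) ∘ dγ(ζ)`. -/
def JHolOn (J : F → F →L[ℝ] F) (D : Set ℂ) (γ : ℂ → F) : Prop :=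
  ∀ ζ ∈ D, ∀ v : ℂ, fderiv ℝ γ ζ (Complex.I * v) = J (γ ζ) (fderiv ℝ γ ζ v)


/-- Lie bracket of vector fields: `[X,Y](p) = dY(p)(X(p)) − dX(p)(Y(p))`. -/
def lieVF (X Y : F → F) : F → F :=
  fun p => fderiv ℝ Y p (X p) - fderiv ℝ X p (Y p)

/-- The vector field `JX : x ↦ J(x) X(x)`. -/
def Jvf (J : F → F →L[ℝ] F) (X : F → F) : F → F := fun p => J p (X p)

/-- The flat covariant derivative `X · Y : p ↦ dY(p)(X(p))`. -/
def derVF (X Y : F → F) : F → F := fun p => fderiv ℝ Y p (X p)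

/-- `DX X Y k = D_X^{k,0} Y = X·(X·(⋯(X·Y)))` (`k` times). -/
def DX (X Y : F → F) : ℕ → (F → F)
  | 0 => Y
  | k + 1 => derVF X (DX X Y k)

/-- `applyVF [X₁,…,X_k] Z = X₁·(X₂·(⋯(X_k·Z)))`. -/
def applyVF : List (F → F) → (F → F) → (F → F)
  | [], Z => Z
  | Y :: rest, Z => derVF Y (applyVF rest Z)

/-- `nestedLie [X₁,…,X_k] Z = [X₁,[X₂,[…,[X_k, Z]…]]]`. -/
def nestedLie : List (F → F) → (F → F) → (F → F)
  | [], Z => Z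
  | Y :: rest, Z => lieVF Y (nestedLie rest Z)

/-- Selector for elements of `{X, JX}`: `pickVF X JX true = X`, `pickVF X JX false = JX`. -/
def pickVF (X Y : F → F) (b : Bool) : F → F := if b then X else Y

/-- `X` commutes at order `k` at `p`: all iterated Lie brackets of length `l` with
`2 ≤ l ≤ k` of elements of `{X, JX}` vanish at `p`. -/
def CommutesAtOrder (J : F → F →L[ℝ] F) (X : F → F) (k : ℕ) (p : F) : Prop :=
  ∀ m : ℕ, 1 ≤ m → m + 1 ≤ k → ∀ b : Fin m → Bool, ∀ c : Bool,
    nestedLie (List.ofFn fun i => pickVF X (Jvf J X) (b i))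
      (pickVF X (Jvf J X) c) p = 0


/-- A vector field lies in `T^J M` (with `M = {φ = 0}` inside `U`). -/
def InTJM (J : F → F →L[ℝ] F) (φ : F → ℝ) (U : Set F) (X : F → F) : Prop :=
  ∀ q ∈ U, φ q = 0 → fderiv ℝ φ q (X q) = 0 ∧ fderiv ℝ φ q (J q (X q)) = 0

/-- A real analytic section `X = ∑ (a_p + b_p J) L_p` of the subbundle `𝕃` spanned by
`L₁,…,L_ℓ` over `ℂ` (equality required on `U`). -/
def IsSection {n : ℕ} (J : Ecx n → Ecx n →L[ℝ] Ecx n) (U : Set (Ecx n)) {ℓ : ℕ}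
    (L : Fin ℓ → Ecx n → Ecx n) (X : Ecx n → Ecx n) : Prop :=
  ∃ a b : Fin ℓ → Ecx n → ℝ,
    (∀ i, AnalyticOnNhd ℝ (a i) U ∧ AnalyticOnNhd ℝ (b i) U) ∧
    ∀ p ∈ U, X p = ∑ i, (a i p • L i p + b i p • J p (L i p))

/-- `𝕃₀`, the fibre of `𝕃` at the origin. -/
def L0span {n : ℕ} (J : Ecx n → Ecx n →L[ℝ] Ecx n) {ℓ : ℕ}
    (L : Fin ℓ → Ecx n → Ecx n) : Submodule ℝ (Ecx n) :=
  Submodule.span ℝ ((Set.range fun i => L i 0) ∪ (Set.range fun i => J 0 (L i 0)))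

/-- The space of summable real families indexed by bidegrees. The family `c` represents the power
series `∑ c_{jk} (j+k choose j) x^j y^k`. -/
def DoubleSeries : Type := lp (fun _ : ℕ × ℕ => ℝ) 1

namespace DoubleSeries

instance : NormedAddCommGroup DoubleSeries :=
  inferInstanceAs (NormedAddCommGroup (lp (fun _ : ℕ × ℕ => ℝ) 1))

instance : NormedSpace ℝ DoubleSeries :=
  inferInstanceAs (NormedSpace ℝ (lp (fun _ : ℕ × ℕ => ℝ) 1))

instance : CompleteSpace DoubleSeries :=
  inferInstanceAs (CompleteSpace (lp (fun _ : ℕ × ℕ => ℝ) 1))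

/-- The coefficient functional. -/
def coeff (i : ℕ × ℕ) : DoubleSeries →ₗ[ℝ] ℝ where
  toFun f := (show lp (fun _ : ℕ × ℕ => ℝ) 1 from f) i
  map_add' _ _ := rfl
  map_smul' _ _ := rfl

/-- The element representing `(j+k choose j) x^j y^k`. -/
def mono (i : ℕ × ℕ) : DoubleSeries := lp.single 1 i (1 : ℝ)

theorem hasSum_norm_coeff (f : DoubleSeries) : HasSum (fun i => ‖coeff i f‖) ‖f‖ := by
  have h := lp.hasSum_norm (p := 1) (by simp) (show lp (fun _ : ℕ × ℕ => ℝ) 1 from f)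
  simp only [ENNReal.toReal_one, Real.rpow_one] at h
  exact h

theorem norm_mono (i : ℕ × ℕ) : ‖mono i‖ = 1 :=
  (lp.norm_single (E := fun _ : ℕ × ℕ => ℝ) (p := 1) (by simp) i (1 : ℝ)).trans norm_one

theorem norm_coeff_le (i : ℕ × ℕ) (f : DoubleSeries) : ‖coeff i f‖ ≤ ‖f‖ :=
  le_hasSum (hasSum_norm_coeff f) i fun _ _ => norm_nonneg _

/-- The coefficient functional as a continuous linear map. -/
def coeffL (i : ℕ × ℕ) : DoubleSeries →L[ℝ] ℝ :=
  (coeff i).mkContinuous 1 fun f => by simpa using norm_coeff_le i f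

theorem coeff_mono (i j : ℕ × ℕ) : coeff i (mono j) = if i = j then 1 else 0 := by
  change (lp.single 1 j (1 : ℝ) : lp (fun _ : ℕ × ℕ => ℝ) 1) i = _
  simp [Pi.single_apply]

theorem hasSum_mono (f : DoubleSeries) : HasSum (fun i => coeff i f • mono i) f := by
  have h := lp.hasSum_single (E := fun _ : ℕ × ℕ => ℝ) (p := 1) (by simp)
    (show lp (fun _ : ℕ × ℕ => ℝ) 1 from f)
  refine (congrArg (HasSum · f) (funext fun i => ?_)).mpr h
  refine (lp.single_smul (E := fun _ : ℕ × ℕ => ℝ) 1 i (coeff i f) (1 : ℝ)).symm.trans ?_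
  rw [smul_eq_mul, mul_one]
  rfl

variable {V : Type*} [NormedAddCommGroup V] [NormedSpace ℝ V]

theorem clm_ext {A B : DoubleSeries →L[ℝ] V} (h : ∀ i, A (mono i) = B (mono i)) : A = B := by
  ext f
  have hA := A.hasSum (hasSum_mono f)
  have hB := B.hasSum (hasSum_mono f)
  simp only [map_smul, h] at hA hB
  exact hA.unique hB

theorem clm_ext₂ {A B : DoubleSeries →L[ℝ] DoubleSeries →L[ℝ] V}
    (h : ∀ i j, A (mono i) (mono j) = B (mono i) (mono j)) : A = B :=
  clm_ext fun i => clm_ext fun j => h i j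

theorem summable_lift [CompleteSpace V] (v : ℕ × ℕ → V) (hv : ∀ i, ‖v i‖ ≤ 1)
    (f : DoubleSeries) : Summable fun i => coeff i f • v i :=
  .of_norm_bounded (hasSum_norm_coeff f).summable fun i => by
    rw [norm_smul]; exact mul_le_of_le_one_right (norm_nonneg _) (hv i)

/-- The continuous linear map with prescribed bounded values on the monomials. -/
def lift [CompleteSpace V] (v : ℕ × ℕ → V) (hv : ∀ i, ‖v i‖ ≤ 1) : DoubleSeries →L[ℝ] V :=
  LinearMap.mkContinuous
    { toFun := fun f => ∑' i, coeff i f • v i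
      map_add' := fun f g => by
        rw [← (summable_lift v hv f).tsum_add (summable_lift v hv g)]
        simp [add_smul]
      map_smul' := fun c f => by
        rw [RingHom.id_apply, ← (summable_lift v hv f).tsum_const_smul]
        simp [mul_smul] } 1 fun f => by
    rw [one_mul]
    refine tsum_of_norm_bounded (hasSum_norm_coeff f) fun i => ?_
    rw [norm_smul]; exact mul_le_of_le_one_right (norm_nonneg _) (hv i)

theorem norm_lift_le [CompleteSpace V] (v : ℕ × ℕ → V) (hv : ∀ i, ‖v i‖ ≤ 1) :
    ‖lift v hv‖ ≤ 1 :=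
  LinearMap.mkContinuous_norm_le _ zero_le_one _

@[simp]
theorem lift_mono [CompleteSpace V] (v : ℕ × ℕ → V) (hv : ∀ i, ‖v i‖ ≤ 1) (i : ℕ × ℕ) :
    lift v hv (mono i) = v i := by
  change ∑' j, coeff j (mono i) • v j = v i
  rw [tsum_eq_single i fun j hj => by simp [coeff_mono, hj]]
  simp [coeff_mono]

/-- The binomial coefficient attached to a bidegree. -/
def binom (i : ℕ × ℕ) : ℕ := (i.1 + i.2).choose i.1

theorem binom_pos (i : ℕ × ℕ) : 0 < binom i := Nat.choose_pos (Nat.le_add_right _ _)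

theorem binom_ne_zero (i : ℕ × ℕ) : (binom i : ℝ) ≠ 0 := by
  exact_mod_cast (binom_pos i).ne'

theorem binom_mul_le (i j : ℕ × ℕ) : binom i * binom j ≤ binom (i + j) := by
  simp only [binom, Prod.fst_add, Prod.snd_add]
  rw [show i.1 + j.1 + (i.2 + j.2) = (i.1 + i.2) + (j.1 + j.2) by ring,
    Nat.add_choose_eq (i.1 + i.2) (j.1 + j.2)]
  exact Finset.single_le_sum (f := fun ij : ℕ × ℕ =>
    (i.1 + i.2).choose ij.1 * (j.1 + j.2).choose ij.2) (fun _ _ => Nat.zero_le _)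
    (a := (i.1, j.1)) (Finset.HasAntidiagonal.mem_antidiagonal.2 rfl)

theorem binom_le_two_pow (i : ℕ × ℕ) : binom i ≤ 2 ^ (i.1 + i.2) := Nat.choose_le_two_pow _ _

/-- Structure constants of the multiplication. -/
def mulCoeff (i j : ℕ × ℕ) : ℝ := binom i * binom j / binom (i + j)

theorem mulCoeff_nonneg (i j : ℕ × ℕ) : 0 ≤ mulCoeff i j := by
  unfold mulCoeff; positivity

theorem mulCoeff_le_one (i j : ℕ × ℕ) : mulCoeff i j ≤ 1 := by
  unfold mulCoeff
  rw [div_le_one (by exact_mod_cast binom_pos _)]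
  exact_mod_cast binom_mul_le i j

theorem norm_smul_mono_le {c : ℝ} (h0 : 0 ≤ c) (h1 : c ≤ 1) (i : ℕ × ℕ) :
    ‖c • mono i‖ ≤ 1 := by
  rwa [norm_smul, norm_mono, mul_one, Real.norm_of_nonneg h0]

/-- Multiplication of power series. -/
def mulL : DoubleSeries →L[ℝ] DoubleSeries →L[ℝ] DoubleSeries :=
  lift (fun i => lift (fun j => mulCoeff i j • mono (i + j)) fun j =>
    norm_smul_mono_le (mulCoeff_nonneg i j) (mulCoeff_le_one i j) _) fun _ => norm_lift_le _ _

theorem mulL_mono (i j : ℕ × ℕ) : mulL (mono i) (mono j) = mulCoeff i j • mono (i + j) := by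
  simp [mulL]

theorem mulL_comm (f g : DoubleSeries) : mulL f g = mulL g f := by
  have : mulL = mulL.flip := clm_ext₂ fun i j => by
    simp [mulL_mono, mulCoeff, add_comm i j, mul_comm (binom i : ℝ)]
  exact DFunLike.congr_fun (DFunLike.congr_fun this f) g

theorem mulL_assoc (f g h : DoubleSeries) : mulL (mulL f g) h = mulL f (mulL g h) := by
  have key : ∀ i j k, mulL (mulL (mono i) (mono j)) (mono k) =
      mulL (mono i) (mulL (mono j) (mono k)) := fun i j k => by
    simp only [mulL_mono, map_smul, smul_apply, smul_smul, mulCoeff,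
      add_assoc]
    congr 1
    have := binom_ne_zero (i + j)
    have := binom_ne_zero (j + k)
    field_simp
  have h1 : ∀ i j, mulL (mulL (mono i) (mono j)) = (mulL (mono i)).comp (mulL (mono j)) :=
    fun i j => clm_ext fun k => key i j k
  have h2 : ∀ i, (mulL.flip h).comp (mulL (mono i)) = (mulL (mono i)).comp (mulL.flip h) :=
    fun i => clm_ext fun j => by simp [h1]
  have h3 : (mulL.flip h).comp (mulL.flip g) = mulL.flip (mulL g h) :=
    clm_ext fun i => by simpa using DFunLike.congr_fun (h2 i) g
  exact DFunLike.congr_fun h3 f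

theorem mulL_one (f : DoubleSeries) : mulL (mono 0) f = f := by
  have : mulL (mono 0) = ContinuousLinearMap.id ℝ _ := clm_ext fun i => by
    have := binom_ne_zero i
    have h0 : binom 0 = 1 := rfl
    simp [mulL_mono, mulCoeff, h0, this]
  simp [this]

theorem norm_mulL_le (f g : DoubleSeries) : ‖mulL f g‖ ≤ ‖f‖ * ‖g‖ := by
  have h : ‖mulL‖ ≤ 1 := norm_lift_le _ _
  calc ‖mulL f g‖ ≤ ‖mulL‖ * ‖f‖ * ‖g‖ := mulL.le_opNorm₂ f g
    _ ≤ 1 * ‖f‖ * ‖g‖ := by gcongr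
    _ = _ := by ring

instance : CommRing DoubleSeries where
  __ := (inferInstance : AddCommGroup DoubleSeries)
  mul f g := mulL f g
  one := mono 0
  mul_assoc := mulL_assoc
  mul_comm := mulL_comm
  one_mul := mulL_one
  mul_one f := (mulL_comm _ _).trans (mulL_one f)
  left_distrib f g h := (mulL f).map_add g h
  right_distrib f g h := by
    change mulL (f + g) h = mulL f h + mulL g h
    simp
  zero_mul f := by
    change mulL 0 f = 0
    simp
  mul_zero f := (mulL f).map_zero

theorem mul_def (f g : DoubleSeries) : f * g = mulL f g := rfl

theorem one_def : (1 : DoubleSeries) = mono 0 := rfl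

instance : NormedCommRing DoubleSeries where
  __ := (inferInstance : CommRing DoubleSeries)
  __ := (inferInstance : NormedAddCommGroup DoubleSeries)
  norm_mul_le := norm_mulL_le

instance : Algebra ℝ DoubleSeries :=
  Algebra.ofModule
    (fun c f g => by simp [mul_def]) (fun c f g => by simp [mul_def])

instance : NormedAlgebra ℝ DoubleSeries where
  norm_smul_le c f := (norm_smul c f).le

end DoubleSeries
namespace DoubleSeries

open Finset

/-- The contribution of a bidegree to the multilinear form of `z ↦ ev z`. -/
def evTerm (m : ℕ) (i : ℕ × ℕ) : ContinuousMultilinearMap ℝ (fun _ : Fin m => ℂ)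
    (DoubleSeries →L[ℝ] ℝ) :=
  ((ContinuousMultilinearMap.mkPiAlgebra ℝ (Fin m) ℝ).compContinuousLinearMap
    fun l => if (l : ℕ) < i.1 then Complex.reCLM else Complex.imCLM).smulRight
      ((binom i : ℝ) • coeffL i)

/-- The degree `m` part of `z ↦ ev z`, as a multilinear map with values in the dual. -/
def evSeries : FormalMultilinearSeries ℝ ℂ (DoubleSeries →L[ℝ] ℝ) := fun m =>
  ∑ i ∈ antidiagonal m, evTerm m i

theorem evSeries_apply (m : ℕ) (z : ℂ) :
    evSeries m (fun _ => z) =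
      ∑ i ∈ antidiagonal m, (z.re ^ i.1 * z.im ^ i.2 * binom i) • coeffL i := by
  have key : ∀ i ∈ antidiagonal m,
      ∏ l : Fin m, (if (l : ℕ) < i.1 then Complex.reCLM else Complex.imCLM) z =
        z.re ^ i.1 * z.im ^ i.2 := by
    rintro ⟨a, b⟩ h
    obtain rfl : a + b = m := by simpa using h
    rw [Fin.prod_univ_add]
    simp
  simp only [evSeries, evTerm, _root_.sum_apply, ContinuousMultilinearMap.smulRight_apply,
    ContinuousMultilinearMap.compContinuousLinearMap_apply,
    ContinuousMultilinearMap.mkPiAlgebra_apply]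
  exact sum_congr rfl fun i hi => by rw [key i hi, smul_smul]

theorem norm_coeffL_le (i : ℕ × ℕ) : ‖coeffL i‖ ≤ 1 :=
  LinearMap.mkContinuous_norm_le _ zero_le_one _

theorem norm_evTerm_le {m : ℕ} {i : ℕ × ℕ} (hi : i.1 + i.2 = m) : ‖evTerm m i‖ ≤ 2 ^ m := by
  refine ContinuousMultilinearMap.opNorm_le_bound (by positivity) fun v => ?_
  have h1 : ‖(binom i : ℝ) • coeffL i‖ ≤ 2 ^ m := by
    rw [norm_smul, ← mul_one ((2 : ℝ) ^ m)]
    refine mul_le_mul ?_ (norm_coeffL_le i) (norm_nonneg _) (by positivity)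
    rw [Real.norm_of_nonneg (by positivity), ← hi]
    exact_mod_cast binom_le_two_pow i
  have h2 : ‖∏ l : Fin m, (if (l : ℕ) < i.1 then Complex.reCLM else Complex.imCLM) (v l)‖ ≤
      ∏ l, ‖v l‖ := by
    rw [norm_prod]
    refine prod_le_prod (fun _ _ => norm_nonneg _) fun l _ => ?_
    split_ifs
    · exact Complex.abs_re_le_norm _
    · exact Complex.abs_im_le_norm _
  rw [evTerm, ContinuousMultilinearMap.smulRight_apply,
    ContinuousMultilinearMap.compContinuousLinearMap_apply,
    ContinuousMultilinearMap.mkPiAlgebra_apply, norm_smul, mul_comm]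
  exact mul_le_mul h1 h2 (norm_nonneg _) (by positivity)

theorem norm_evSeries_le (m : ℕ) : ‖evSeries m‖ ≤ 4 ^ m := by
  calc ‖evSeries m‖ ≤ ∑ i ∈ antidiagonal m, (2 : ℝ) ^ m :=
      (norm_sum_le (antidiagonal m) (evTerm m)).trans <| sum_le_sum fun i hi =>
        norm_evTerm_le (mem_antidiagonal.1 hi)
    _ = (m + 1 : ℕ) * 2 ^ m := by simp
    _ ≤ 2 ^ m * 2 ^ m := by
      gcongr
      exact_mod_cast Nat.lt_two_pow_self
    _ = 4 ^ m := by rw [← mul_pow]; norm_num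

theorem radius_evSeries_pos : 0 < evSeries.radius := by
  refine lt_of_lt_of_le ?_ (evSeries.le_radius_of_bound 1 (r := 1 / 4) fun m => ?_)
  · norm_num
  · calc ‖evSeries m‖ * ((1 / 4 : NNReal) : ℝ) ^ m ≤ 4 ^ m * ((1 / 4 : NNReal) : ℝ) ^ m := by
          gcongr; exact norm_evSeries_le m
      _ ≤ 1 := by rw [← mul_pow]; norm_num

/-- Evaluation of a power series at the point `x + iy`. -/
def ev (z : ℂ) : DoubleSeries →L[ℝ] ℝ := evSeries.sum z

theorem hasFPowerSeriesOnBall_ev : HasFPowerSeriesOnBall ev evSeries 0 evSeries.radius :=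
  evSeries.hasFPowerSeriesOnBall radius_evSeries_pos

theorem analyticAt_ev : AnalyticAt ℝ ev 0 := hasFPowerSeriesOnBall_ev.analyticAt

theorem ev_mono {z : ℂ} (hz : z ∈ Metric.eball 0 evSeries.radius) (i : ℕ × ℕ) :
    ev z (mono i) = z.re ^ i.1 * z.im ^ i.2 * binom i := by
  have h := hasFPowerSeriesOnBall_ev.hasSum hz
  rw [zero_add] at h
  have h2 := (ContinuousLinearMap.apply ℝ ℝ (mono i)).hasSum h
  refine h2.unique ?_
  convert hasSum_single (i.1 + i.2) ?_ using 1
  · simp only [ContinuousLinearMap.apply_apply, evSeries_apply]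
    simp [coeffL, coeff_mono]
  · intro m hm
    simp only [ContinuousLinearMap.apply_apply, evSeries_apply]
    simp [coeffL, coeff_mono, Ne.symm hm]

theorem eventually_mem_eball : ∀ᶠ z : ℂ in nhds 0, z ∈ Metric.eball 0 evSeries.radius :=
  Metric.eball_mem_nhds _ radius_evSeries_pos

theorem ev_mul {z : ℂ} (hz : z ∈ Metric.eball 0 evSeries.radius) (f g : DoubleSeries) :
    ev z (f * g) = ev z f * ev z g := by
  have : (ContinuousLinearMap.compL ℝ DoubleSeries DoubleSeries ℝ (ev z)).comp mulL =
      (ContinuousLinearMap.mul ℝ ℝ).bilinearComp (ev z) (ev z) := clm_ext₂ fun i j => by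
    have := binom_ne_zero (i + j)
    simp only [ContinuousLinearMap.comp_apply, ContinuousLinearMap.compL_apply, mulL_mono,
      map_smul, ev_mono hz, smul_eq_mul, ContinuousLinearMap.bilinearComp_apply,
      ContinuousLinearMap.mul_apply', mulCoeff]
    field_simp
    simp only [Prod.fst_add, Prod.snd_add, pow_add]
    ring
  exact DFunLike.congr_fun (DFunLike.congr_fun this f) g

theorem ev_one {z : ℂ} (hz : z ∈ Metric.eball 0 evSeries.radius) : ev z 1 = 1 := by
  rw [one_def, ev_mono hz]
  simp [binom]

/-- Evaluation at a point near `0`, as an algebra homomorphism. -/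
def evHom {z : ℂ} (hz : z ∈ Metric.eball 0 evSeries.radius) : DoubleSeries →ₐ[ℝ] ℝ :=
  AlgHom.ofLinearMap (ev z) (ev_one hz) (ev_mul hz)

theorem continuous_evHom {z : ℂ} (hz : z ∈ Metric.eball 0 evSeries.radius) :
    Continuous (evHom hz) := (ev z).continuous

theorem evHom_apply {z : ℂ} (hz : z ∈ Metric.eball 0 evSeries.radius) (f : DoubleSeries) :
    evHom hz f = ev z f := rfl

theorem differentiableAt_ev {z : ℂ} (hz : z ∈ Metric.eball 0 evSeries.radius) :
    DifferentiableAt ℝ ev z :=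
  (hasFPowerSeriesOnBall_ev.analyticOnNhd z hz).differentiableAt

theorem fderiv_ev_mono {z : ℂ} (hz : z ∈ Metric.eball 0 evSeries.radius) (v : ℂ) (i : ℕ × ℕ) :
    fderiv ℝ ev z v (mono i) = (i.1 * z.re ^ (i.1 - 1) * v.re * z.im ^ i.2 +
      z.re ^ i.1 * (i.2 * z.im ^ (i.2 - 1) * v.im)) * binom i := by
  have h1 : HasFDerivAt (fun w => ev w (mono i))
      ((ContinuousLinearMap.apply ℝ ℝ (mono i)).comp (fderiv ℝ ev z)) z :=
    (ContinuousLinearMap.apply ℝ ℝ (mono i)).hasFDerivAt.comp z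
      (differentiableAt_ev hz).hasFDerivAt
  have h2 : (fun w : ℂ => w.re ^ i.1 * w.im ^ i.2 * (binom i : ℝ)) =ᶠ[nhds z]
      fun w => ev w (mono i) := by
    filter_upwards [Metric.isOpen_eball.mem_nhds hz] with w hw using (ev_mono hw i).symm
  have h3 := (((Complex.reCLM.hasFDerivAt (x := z)).pow i.1).mul
    ((Complex.imCLM.hasFDerivAt (x := z)).pow i.2)).mul_const (binom i : ℝ)
  have h4 := DFunLike.congr_fun ((h1.congr_of_eventuallyEq h2).unique h3) v
  simp only [ContinuousLinearMap.comp_apply, ContinuousLinearMap.apply_apply] at h4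
  rw [h4]
  simp
  ring

end DoubleSeries
namespace DoubleSeries

/-- The bilinear operation `(g, f) ↦ ∫_y g ∂_x f`. -/
def intMulDeriv : DoubleSeries →L[ℝ] DoubleSeries →L[ℝ] DoubleSeries :=
  lift (fun i => lift
    (fun j => (mulCoeff i j * (j.1 / (i.1 + j.1 : ℕ))) • mono (i.1 + j.1 - 1, i.2 + j.2 + 1))
    fun j => norm_smul_mono_le (mul_nonneg (mulCoeff_nonneg i j) (by positivity))
      (mul_le_one₀ (mulCoeff_le_one i j) (by positivity)
        (div_le_one_of_le₀ (by push_cast; linarith [(i.1.cast_nonneg : (0 : ℝ) ≤ i.1)])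
          (by positivity))) _)
    fun _ => norm_lift_le _ _

theorem intMulDeriv_mono (i j : ℕ × ℕ) : intMulDeriv (mono i) (mono j) =
    (mulCoeff i j * (j.1 / (i.1 + j.1 : ℕ))) • mono (i.1 + j.1 - 1, i.2 + j.2 + 1) := by
  simp [intMulDeriv]

/-- The operator `f ↦ ∫_0^x f(·, 0)`. -/
def intAxis : DoubleSeries →L[ℝ] DoubleSeries :=
  lift (fun j => (if j.2 = 0 then 1 / (j.1 + 1 : ℝ) else 0) • mono (j.1 + 1, 0)) fun j => by
    refine norm_smul_mono_le ?_ ?_ _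
    · split_ifs <;> positivity
    · split_ifs
      · exact div_le_one_of_le₀ (by linarith [(j.1.cast_nonneg : (0 : ℝ) ≤ j.1)]) (by positivity)
      · exact zero_le_one

theorem intAxis_mono (j : ℕ × ℕ) : intAxis (mono j) =
    (if j.2 = 0 then 1 / (j.1 + 1 : ℝ) else 0) • mono (j.1 + 1, 0) := by
  simp [intAxis]

theorem binom_pred_succ {p : ℕ} (hp : p ≠ 0) (q : ℕ) :
    (binom (p - 1, q + 1) : ℝ) * (q + 1) = binom (p, q) * p := by
  obtain ⟨p, rfl⟩ := Nat.exists_eq_succ_of_ne_zero hp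
  have h := Nat.choose_succ_right_eq (p + 1 + q) p
  rw [show p + 1 + q - p = q + 1 by omega] at h
  simp only [binom, Nat.succ_eq_add_one, Nat.add_sub_cancel]
  rw [show p + (q + 1) = p + 1 + q by ring]
  exact_mod_cast h.symm

variable {z : ℂ}

theorem fderiv_ev_intMulDeriv (hz : z ∈ eball 0 evSeries.radius) (g f : DoubleSeries) :
    fderiv ℝ ev z Complex.I (intMulDeriv g f) = ev z g * fderiv ℝ ev z 1 f := by
  have : (ContinuousLinearMap.compL ℝ DoubleSeries DoubleSeries ℝ
      (fderiv ℝ ev z Complex.I)).comp intMulDeriv =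
      (ContinuousLinearMap.mul ℝ ℝ).bilinearComp (ev z) (fderiv ℝ ev z 1) :=
    clm_ext₂ fun i j => by
      simp only [ContinuousLinearMap.comp_apply, ContinuousLinearMap.compL_apply,
        intMulDeriv_mono, map_smul, ev_mono hz, fderiv_ev_mono hz, smul_eq_mul,
        ContinuousLinearMap.bilinearComp_apply, ContinuousLinearMap.mul_apply', mulCoeff,
        Complex.I_re, Complex.I_im, Complex.one_re, Complex.one_im]
      rcases Nat.eq_zero_or_pos j.1 with h | h
      · simp [h]
      · have hp : i.1 + j.1 ≠ 0 := by omega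
        have h1 := binom_ne_zero (i + j)
        have h2 := binom_pred_succ hp (i.2 + j.2)
        have h3 : ((i.1 + j.1 : ℕ) : ℝ) ≠ 0 := by exact_mod_cast hp
        have h4 : i.1 + j.1 - 1 = i.1 + (j.1 - 1) := by omega
        rw [show i + j = (i.1 + j.1, i.2 + j.2) from rfl] at h1 ⊢
        simp only [Nat.add_sub_cancel, mul_zero, zero_mul, zero_add, mul_one, add_zero]
        have h5 : (binom (i.1 + j.1 - 1, i.2 + j.2 + 1) : ℝ) * ((i.2 + j.2 + 1 : ℕ) : ℝ) =
          binom (i.1 + j.1, i.2 + j.2) * (i.1 + j.1 : ℕ) := by rw [← h2]; push_cast; ring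
        calc _ = z.re ^ (i.1 + j.1 - 1) * z.im ^ (i.2 + j.2) * binom i * binom j * j.1 *
              ((binom (i.1 + j.1 - 1, i.2 + j.2 + 1) : ℝ) * ((i.2 + j.2 + 1 : ℕ) : ℝ)) /
              (binom (i.1 + j.1, i.2 + j.2) * (i.1 + j.1 : ℕ)) := by field_simp
          _ = z.re ^ (i.1 + j.1 - 1) * z.im ^ (i.2 + j.2) * binom i * binom j * j.1 := by
              rw [h5]; field_simp
          _ = _ := by rw [h4, pow_add, pow_add]; ring
  exact DFunLike.congr_fun (DFunLike.congr_fun this g) f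

theorem fderiv_ev_one_intMulDeriv (hz : z ∈ eball 0 evSeries.radius) (h0 : z.im = 0)
    (g f : DoubleSeries) : fderiv ℝ ev z 1 (intMulDeriv g f) = 0 := by
  have : (ContinuousLinearMap.compL ℝ DoubleSeries DoubleSeries ℝ
      (fderiv ℝ ev z 1)).comp intMulDeriv = 0 := clm_ext₂ fun i j => by
    simp [intMulDeriv_mono, fderiv_ev_mono hz, h0]
  exact DFunLike.congr_fun (DFunLike.congr_fun this g) f

theorem ev_zero_intMulDeriv (g f : DoubleSeries) : ev 0 (intMulDeriv g f) = 0 := by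
  have : (ContinuousLinearMap.compL ℝ DoubleSeries DoubleSeries ℝ (ev 0)).comp intMulDeriv = 0 :=
    clm_ext₂ fun i j => by
      simp [intMulDeriv_mono, ev_mono (mem_eball_self radius_evSeries_pos)]
  exact DFunLike.congr_fun (DFunLike.congr_fun this g) f

theorem fderiv_ev_I_intAxis (hz : z ∈ eball 0 evSeries.radius) (f : DoubleSeries) :
    fderiv ℝ ev z Complex.I (intAxis f) = 0 := by
  have : (fderiv ℝ ev z Complex.I).comp intAxis = 0 := clm_ext fun j => by
    simp [intAxis_mono, fderiv_ev_mono hz, -ite_smul]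
  exact DFunLike.congr_fun this f

theorem fderiv_ev_one_intAxis (hz : z ∈ eball 0 evSeries.radius) (h0 : z.im = 0)
    (f : DoubleSeries) : fderiv ℝ ev z 1 (intAxis f) = ev z f := by
  have : (fderiv ℝ ev z 1).comp intAxis = ev z := clm_ext fun j => by
    have : (j.1 + 1 : ℝ) ≠ 0 := by positivity
    by_cases h : j.2 = 0
    · simp [intAxis_mono, fderiv_ev_mono hz, ev_mono hz, h, binom]
      field_simp
    · simp [intAxis_mono, ev_mono hz, h0, h]
  exact DFunLike.congr_fun this f

theorem ev_zero_intAxis (f : DoubleSeries) : ev 0 (intAxis f) = 0 := by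
  have : (ev 0).comp intAxis = 0 := clm_ext fun j => by
    simp [intAxis_mono, ev_mono (mem_eball_self radius_evSeries_pos), -ite_smul]
  exact DFunLike.congr_fun this f

end DoubleSeries
section Substitution

variable {F : Type*} [NormedAddCommGroup F] [NormedSpace ℝ F] {ι : Type*} [Fintype ι]
  (b : Module.Basis ι ℝ F) (𝒜 : Type*) [NormedCommRing 𝒜] [NormedAlgebra ℝ 𝒜]

/-- Extension of a power series on `F` to coordinate vectors with entries in an algebra. -/
def algSeries (p : FormalMultilinearSeries ℝ F ℝ) : FormalMultilinearSeries ℝ (ι → 𝒜) 𝒜 :=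
  fun m => ∑ i : Fin m → ι, p m (fun l => b (i l)) •
    (ContinuousMultilinearMap.mkPiAlgebra ℝ (Fin m) 𝒜).compContinuousLinearMap
      fun l => ContinuousLinearMap.proj (R := ℝ) (φ := fun _ : ι => 𝒜) (i l)

theorem algSeries_apply (p : FormalMultilinearSeries ℝ F ℝ) (m : ℕ) (u : ι → 𝒜) :
    algSeries b 𝒜 p m (fun _ => u) =
      ∑ i : Fin m → ι, p m (fun l => b (i l)) • ∏ l, u (i l) := by
  simp [algSeries]

theorem map_algSeries (p : FormalMultilinearSeries ℝ F ℝ) (m : ℕ) (u : ι → 𝒜)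
    (e : 𝒜 →ₐ[ℝ] ℝ) :
    e (algSeries b 𝒜 p m fun _ => u) = p m fun _ => ∑ i, e (u i) • b i := by
  classical
  rw [algSeries_apply, map_sum, ContinuousMultilinearMap.map_sum]
  refine Finset.sum_congr rfl fun i _ => ?_
  rw [ContinuousMultilinearMap.map_smul_univ, map_smul, map_prod, smul_eq_mul, smul_eq_mul,
    mul_comm]

theorem norm_algSeries_le [NormOneClass 𝒜] (p : FormalMultilinearSeries ℝ F ℝ) (m : ℕ) :
    ‖algSeries b 𝒜 p m‖ ≤ ‖p m‖ * (∑ i, ‖b i‖) ^ m := by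
  classical
  have hterm (i : Fin m → ι) :
      ‖(ContinuousMultilinearMap.mkPiAlgebra ℝ (Fin m) 𝒜).compContinuousLinearMap
        fun l => ContinuousLinearMap.proj (R := ℝ) (φ := fun _ : ι => 𝒜) (i l)‖ ≤ 1 := by
    refine ContinuousMultilinearMap.opNorm_le_bound zero_le_one fun u => ?_
    rw [one_mul]
    rw [ContinuousMultilinearMap.compContinuousLinearMap_apply,
      ContinuousMultilinearMap.mkPiAlgebra_apply]
    refine (Finset.norm_prod_le (α := 𝒜) _ _).trans ?_
    exact Finset.prod_le_prod (fun _ _ => norm_nonneg _) fun l _ => norm_le_pi_norm (u l) (i l)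
  calc ‖algSeries b 𝒜 p m‖ ≤ ∑ i : Fin m → ι, ‖p m‖ * ∏ l, ‖b (i l)‖ := by
        refine (norm_sum_le _ _).trans (Finset.sum_le_sum fun i _ => ?_)
        rw [norm_smul]
        exact (mul_le_of_le_one_right (norm_nonneg _) (hterm i)).trans ((p m).le_opNorm _)
    _ = _ := by
        rw [← Finset.mul_sum, Finset.sum_pow', Fintype.piFinset_univ]

theorem radius_algSeries_pos [NormOneClass 𝒜] {p : FormalMultilinearSeries ℝ F ℝ}
    (hp : 0 < p.radius) : 0 < (algSeries b 𝒜 p).radius := by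
  obtain ⟨r, hr0, hr⟩ := ENNReal.lt_iff_exists_nnreal_btwn.1 hp
  have hr0 : 0 < r := by exact_mod_cast hr0
  obtain ⟨C, hC, h⟩ := p.norm_le_div_pow_of_pos_of_lt_radius hr0 hr
  set K : ℝ := ∑ i, ‖b i‖
  have hK : 0 ≤ K := Finset.sum_nonneg fun _ _ => norm_nonneg _
  have hr' : (0 : ℝ) < r := hr0
  let s : NNReal := ⟨r / (K + 1), by positivity⟩
  have hs : 0 < s := NNReal.coe_pos.1 (show (0 : ℝ) < r / (K + 1) by positivity)
  refine lt_of_lt_of_le (ENNReal.coe_pos.2 hs) ((algSeries b 𝒜 p).le_radius_of_bound C fun m => ?_)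
  calc ‖algSeries b 𝒜 p m‖ * (r / (K + 1)) ^ m ≤ C / r ^ m * K ^ m * (r / (K + 1)) ^ m := by
        gcongr
        exact (norm_algSeries_le b 𝒜 p m).trans (by gcongr; exact h m)
    _ = C * (K / (K + 1)) ^ m := by
        rw [div_pow, div_pow]; field_simp
    _ ≤ C := by
        refine mul_le_of_le_one_right hC.le (pow_le_one₀ (by positivity) ?_)
        exact div_le_one_of_le₀ (by linarith) (by positivity)

/-- Analytic functions can be evaluated at coordinate vectors with small entries in a commutative
Banach algebra, compatibly with characters. -/
theorem exists_substitution [NormOneClass 𝒜] [CompleteSpace 𝒜] {f : F → ℝ}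
    (hf : AnalyticAt ℝ f 0) :
    ∃ S : (ι → 𝒜) → 𝒜, AnalyticAt ℝ S 0 ∧ ∃ V ∈ nhds (0 : F), ∀ᶠ u in nhds (0 : ι → 𝒜),
      ∀ e : 𝒜 →ₐ[ℝ] ℝ, Continuous e → ∑ i, e (u i) • b i ∈ V →
        e (S u) = f (∑ i, e (u i) • b i) := by
  obtain ⟨p, r, hp⟩ := hf
  have hpos := radius_algSeries_pos b 𝒜 hp.radius_pos
  have hS := (algSeries b 𝒜 p).hasFPowerSeriesOnBall hpos
  refine ⟨_, hS.analyticAt, eball 0 r, eball_mem_nhds _ hp.r_pos, ?_⟩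
  filter_upwards [eball_mem_nhds _ hpos] with u hu e he hv
  have h1 := hS.hasSum hu
  rw [zero_add] at h1
  have h2 := h1.map e he
  have h3 := hp.hasSum hv
  rw [zero_add] at h3
  refine h2.unique ((congrArg (HasSum · _) (funext fun m => ?_)).mpr h3)
  exact map_algSeries b 𝒜 p m u e

end Substitution
namespace DoubleSeries

instance : NormOneClass DoubleSeries := ⟨norm_mono 0⟩

variable {F : Type*} [NormedAddCommGroup F] [NormedSpace ℝ F] {ι : Type*} [Fintype ι]
  (b : Module.Basis ι ℝ F)

/-- The map into `F` whose coordinates are given by power series. -/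
def evVec (u : ι → DoubleSeries) (z : ℂ) : F := ∑ i, ev z (u i) • b i

theorem analyticAt_evVec (u : ι → DoubleSeries) : AnalyticAt ℝ (evVec b u) 0 :=
  Finset.analyticAt_fun_sum _ fun i _ =>
    (((ContinuousLinearMap.apply ℝ ℝ (u i)).analyticAt _).comp analyticAt_ev).smul analyticAt_const

theorem hasFDerivAt_evVec (u : ι → DoubleSeries) {z : ℂ} (hz : z ∈ eball 0 evSeries.radius) :
    HasFDerivAt (evVec b u) (∑ i, (((ContinuousLinearMap.apply ℝ ℝ (u i)).comp
      (fderiv ℝ ev z)).smulRight (b i))) z :=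
  HasFDerivAt.fun_sum fun i _ => ((ContinuousLinearMap.apply ℝ ℝ (u i)).hasFDerivAt.comp z
    (differentiableAt_ev hz).hasFDerivAt).smul_const (b i)

theorem fderiv_evVec (u : ι → DoubleSeries) {z : ℂ} (hz : z ∈ eball 0 evSeries.radius) (w : ℂ) :
    fderiv ℝ (evVec b u) z w = ∑ i, fderiv ℝ ev z w (u i) • b i := by
  rw [(hasFDerivAt_evVec b u hz).fderiv]
  simp

/-- A small multiple of a strictly differentiable map has a fixed point near `0`. -/
theorem exists_small_fixedPoint {E : Type*} [NormedAddCommGroup E] [NormedSpace ℝ E]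
    [CompleteSpace E] {Θ : E → E} {Θ' : E →L[ℝ] E} (hΘ : HasStrictFDerivAt Θ Θ' 0) {P : E → Prop}
    (hP : ∀ᶠ u in nhds 0, P u) : ∃ s : ℝ, s ≠ 0 ∧ ∃ u, u = s • Θ u ∧ P u := by
  have hΨ : HasStrictFDerivAt (fun q : ℝ × E => (q.1, q.2 - q.1 • Θ q.2)) _ (0 : ℝ × E) :=
    hasStrictFDerivAt_fst.prodMk (hasStrictFDerivAt_snd.sub
      (hasStrictFDerivAt_fst.smul (HasStrictFDerivAt.comp (g := Θ) (0 : ℝ × E) hΘ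
        hasStrictFDerivAt_snd)))
  have hmap := hΨ.map_nhds_eq_of_surj (by
    rw [LinearMap.range_eq_top]
    rintro ⟨s, w⟩
    exact ⟨(s, w + s • Θ 0), by simp⟩)
  have hmem : {q : ℝ × E | P q.2} ∈ nhds (0 : ℝ × E) :=
    (continuous_snd.tendsto' (0 : ℝ × E) (0 : E) rfl).eventually hP
  have himg := Filter.image_mem_map (m := fun q : ℝ × E => (q.1, q.2 - q.1 • Θ q.2)) hmem
  rw [hmap] at himg
  have hc : Filter.Tendsto (fun s : ℝ => (s, (0 : E))) (nhdsWithin 0 {0}ᶜ)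
      (nhds ((0 : ℝ × E).1, (0 : ℝ × E).2 - (0 : ℝ × E).1 • Θ (0 : ℝ × E).2)) :=
    (Continuous.tendsto' (by fun_prop) _ _ (by simp)).mono_left nhdsWithin_le_nhds
  obtain ⟨s, ⟨⟨s', u⟩, hu, hq⟩, hs⟩ := ((hc.eventually himg).and self_mem_nhdsWithin).exists
  obtain ⟨rfl, h2⟩ := Prod.mk.inj hq
  exact ⟨s', hs, u, sub_eq_zero.1 h2, hu⟩

end DoubleSeries

open DoubleSeries in
/-- A Cauchy-Kovalevskaya theorem: an analytic almost complex structure and an analytic vector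
field determine a pseudoholomorphic disc along whose real axis the derivative is the field. -/
theorem exists_pseudoholomorphic_germ {F : Type*} [NormedAddCommGroup F] [NormedSpace ℝ F]
    [FiniteDimensional ℝ F] {J : F → F →L[ℝ] F} {X : F → F} (hJ : AnalyticAt ℝ J 0)
    (hX : AnalyticAt ℝ X 0) :
    ∃ γ : ℂ → F, AnalyticAt ℝ γ 0 ∧ γ 0 = 0 ∧
      (∀ᶠ ζ in nhds 0, fderiv ℝ γ ζ Complex.I = J (γ ζ) (fderiv ℝ γ ζ 1)) ∧
      ∀ᶠ t : ℝ in nhds 0, fderiv ℝ γ t 1 = X (γ t) := by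
  let b := Module.finBasis ℝ F
  let co (i) : F →L[ℝ] ℝ := LinearMap.toContinuousLinearMap (b.coord i)
  have hext {v w : F} (h : ∀ i, co i v = co i w) : v = w := b.ext_elem h
  have hco (i) (c : Fin (Module.finrank ℝ F) → ℝ) : co i (∑ j, c j • b j) = c i := by
    simp [co, Finsupp.single_apply]
  have hXi (i) : AnalyticAt ℝ (fun p => co i (X p)) 0 := ((co i).analyticAt _).comp hX
  have hJij (i j) : AnalyticAt ℝ (fun p => co i (J p (b j))) 0 :=
    ((co i).analyticAt _).comp (((ContinuousLinearMap.apply ℝ F (b j)).analyticAt _).comp hJ)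
  choose SX hSX VX hVX hevX using fun i => exists_substitution b DoubleSeries (hXi i)
  choose SJ hSJ VJ hVJ hevJ using fun i j => exists_substitution b DoubleSeries (hJij i j)
  let Θ (u : Fin (Module.finrank ℝ F) → DoubleSeries) (i : Fin (Module.finrank ℝ F)) :
    DoubleSeries := intAxis (SX i u) + ∑ j, intMulDeriv (SJ i j u) (u j)
  have hΘ : AnalyticAt ℝ Θ 0 := by
    refine analyticAt_pi_iff.2 fun i => ?_
    refine ((intAxis.analyticAt _).comp (hSX i)).add (Finset.analyticAt_fun_sum _ fun j _ => ?_)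
    have h1 : AnalyticAt ℝ (fun u : Fin (Module.finrank ℝ F) → DoubleSeries => u j) 0 :=
      (ContinuousLinearMap.proj (R := ℝ) (φ := fun _ => DoubleSeries) j).analyticAt _
    exact (intMulDeriv.analyticAt_bilinear _).comp₂ (hSJ i j) h1
  obtain ⟨s, hs, u, hu, hevX, hevJ⟩ := exists_small_fixedPoint hΘ.hasStrictFDerivAt
    ((Filter.eventually_all.2 hevX).and
      (Filter.eventually_all.2 fun i => Filter.eventually_all.2 (hevJ i)))
  have hui (i) : u i = s • (intAxis (SX i u) + ∑ j, intMulDeriv (SJ i j u) (u j)) :=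
    congrFun hu i
  set v := evVec b u with hv_def
  have hv0 : v 0 = 0 := Finset.sum_eq_zero fun i _ => by
    rw [hui i]
    simp [ev_zero_intAxis, ev_zero_intMulDeriv]
  have hv : AnalyticAt ℝ v 0 := analyticAt_evVec b u
  have hVmem : ∀ᶠ z in nhds 0, (∀ i, v z ∈ VX i) ∧ ∀ i j, v z ∈ VJ i j := by
    have hc : Filter.Tendsto v (nhds 0) (nhds 0) := by simpa [hv0] using hv.continuousAt.tendsto
    exact (Filter.eventually_all.2 fun i => hc (hVX i)).and
      (Filter.eventually_all.2 fun i => Filter.eventually_all.2 fun j => hc (hVJ i j))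
  have hDy : ∀ᶠ z in nhds 0, fderiv ℝ v z Complex.I = s • J (v z) (fderiv ℝ v z 1) := by
    filter_upwards [hVmem, eventually_mem_eball] with z hz hball
    rw [hv_def, fderiv_evVec b u hball, fderiv_evVec b u hball, map_sum, Finset.smul_sum]
    refine hext fun i => ?_
    rw [hco]
    simp only [map_sum, map_smul, smul_eq_mul]
    conv_lhs => rw [hui i]
    rw [map_smul, map_add, fderiv_ev_I_intAxis hball, map_sum, zero_add, smul_eq_mul,
      Finset.mul_sum]
    refine Finset.sum_congr rfl fun j _ => ?_
    rw [fderiv_ev_intMulDeriv hball]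
    have := hevJ i j (evHom hball) (continuous_evHom hball) (hz.2 i j)
    rw [evHom_apply] at this
    rw [this]
    simp only [evHom_apply, evVec]
    ring
  have hDx : ∀ᶠ z in nhds (0 : ℂ), z.im = 0 → fderiv ℝ v z 1 = s • X (v z) := by
    filter_upwards [hVmem, eventually_mem_eball] with z hz hball him
    rw [hv_def, fderiv_evVec b u hball]
    refine hext fun i => ?_
    rw [hco]
    simp only [map_smul, smul_eq_mul]
    conv_lhs => rw [hui i]
    rw [map_smul, map_add, fderiv_ev_one_intAxis hball him, map_sum,
      Finset.sum_eq_zero fun j _ => fderiv_ev_one_intMulDeriv hball him _ _, add_zero, smul_eq_mul]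
    have := hevX i (evHom hball) (continuous_evHom hball) (hz.1 i)
    rw [evHom_apply] at this
    rw [this]
    simp only [evHom_apply, evVec]
  let Λ : ℂ →L[ℝ] ℂ := Complex.reCLM.smulRight ((s⁻¹ : ℝ) : ℂ) +
    Complex.imCLM.smulRight ((s⁻¹ ^ 2 : ℝ) * Complex.I)
  have hΛ1 : Λ 1 = s⁻¹ • (1 : ℂ) := by simp [Λ]
  have hΛI : Λ Complex.I = (s⁻¹ ^ 2) • Complex.I := by simp [Λ]
  have hΛ : Filter.Tendsto Λ (nhds 0) (nhds 0) := by simpa using Λ.continuous.tendsto 0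
  have hdiff : ∀ᶠ ζ in nhds 0, ∀ w, fderiv ℝ (v ∘ Λ) ζ w = fderiv ℝ v (Λ ζ) (Λ w) := by
    filter_upwards [hΛ.eventually hv.eventually_analyticAt] with ζ hζ w
    rw [fderiv_comp _ hζ.differentiableAt Λ.differentiableAt, Λ.fderiv]
    rfl
  refine ⟨v ∘ Λ, AnalyticAt.comp (by simpa using hv) (Λ.analyticAt 0), by simp [hv0], ?_, ?_⟩
  · filter_upwards [hdiff, hΛ.eventually hDy] with ζ h1 h2
    rw [h1, h1, hΛ1, hΛI, map_smul, map_smul, map_smul, h2, smul_smul, Function.comp_apply]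
    congr 1
    field_simp
  · have ht : Filter.Tendsto (fun t : ℝ => (t : ℂ)) (nhds 0) (nhds 0) :=
      Complex.continuous_ofReal.tendsto' _ _ Complex.ofReal_zero
    filter_upwards [ht.eventually hdiff, ht.eventually (hΛ.eventually hDx)] with t h1 h2
    rw [h1, hΛ1, map_smul, h2 (by simp [Λ]), smul_smul, inv_mul_cancel₀ hs, one_smul,
      Function.comp_apply]
section Vanishing

open Filter Topology

variable {E F G H : Type*} [NormedAddCommGroup E] [NormedSpace ℝ E] [NormedAddCommGroup F]
  [NormedSpace ℝ F] [NormedAddCommGroup G] [NormedSpace ℝ G] [NormedAddCommGroup H]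
  [NormedSpace ℝ H]

/-- All derivatives of `f` of order less than `m` vanish at `0`, and those of order `m` take values
in `S`. -/
def VanishesTo (S : Submodule ℝ F) : ℕ → (E → F) → Prop
  | 0, f => f 0 ∈ S
  | m + 1, f => f 0 = 0 ∧ ∀ v, VanishesTo S m fun z => fderiv ℝ f z v

theorem AnalyticAt.fderiv_apply [CompleteSpace F] {f : E → F} {x : E} (hf : AnalyticAt ℝ f x)
    (v : E) : AnalyticAt ℝ (fun z => fderiv ℝ f z v) x :=
  ((ContinuousLinearMap.apply ℝ F v).analyticAt _).comp hf.fderiv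

theorem AnalyticAt.eventually_differentiableAt [CompleteSpace F] {f : E → F} {x : E}
    (hf : AnalyticAt ℝ f x) : ∀ᶠ z in 𝓝 x, DifferentiableAt ℝ f z :=
  hf.eventually_analyticAt.mono fun _ h => h.differentiableAt

theorem AnalyticAt.fderiv_fderiv_comm [CompleteSpace F] {f : E → F} {x : E}
    (hf : AnalyticAt ℝ f x) (v w : E) :
    (fun z => fderiv ℝ (fun z => fderiv ℝ f z v) z w) =ᶠ[𝓝 x]
      fun z => fderiv ℝ (fun z => fderiv ℝ f z w) z v := by
  filter_upwards [hf.eventually_analyticAt] with z hz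
  have h (u : E) : fderiv ℝ (fun z => fderiv ℝ f z u) z =
      (ContinuousLinearMap.apply ℝ F u).comp (fderiv ℝ (fderiv ℝ f) z) :=
    ((ContinuousLinearMap.apply ℝ F u).hasFDerivAt.comp z
      hz.fderiv.differentiableAt.hasFDerivAt).fderiv
  simp only [h]
  exact (hz.contDiffAt (n := ⊤)).isSymmSndFDerivAt (by simp) w v

theorem AnalyticAt.clm_apply {A : E → F →L[ℝ] G} {f : E → F} {x : E} (hA : AnalyticAt ℝ A x)
    (hf : AnalyticAt ℝ f x) : AnalyticAt ℝ (fun z => A z (f z)) x :=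
  ((ContinuousLinearMap.id ℝ (F →L[ℝ] G)).analyticAt_bilinear _).comp₂ hA hf

namespace VanishesTo

variable {S : Submodule ℝ F} {f g : E → F} {m : ℕ}

theorem congr (h : VanishesTo S m f) (hfg : f =ᶠ[𝓝 0] g) : VanishesTo S m g := by
  induction m generalizing f g with
  | zero =>
    rw [VanishesTo, ← hfg.eq_of_nhds]
    exact h
  | succ m ih =>
    exact ⟨hfg.eq_of_nhds ▸ h.1, fun v => ih (h.2 v) (hfg.fderiv.fun_comp fun A => A v)⟩

theorem zero : VanishesTo S m (0 : E → F) := by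
  induction m with
  | zero => exact S.zero_mem
  | succ m ih => exact ⟨rfl, fun v => by simpa using! ih⟩

theorem clm_comp [CompleteSpace F] (hf : AnalyticAt ℝ f 0) (A : F →L[ℝ] G) {T : Submodule ℝ G}
    (hA : ∀ x ∈ S, A x ∈ T) (h : VanishesTo S m f) : VanishesTo T m fun z => A (f z) := by
  induction m generalizing f with
  | zero => exact hA _ h
  | succ m ih =>
    refine ⟨by simp [h.1], fun v => (ih (hf.fderiv_apply v) (h.2 v)).congr ?_⟩
    filter_upwards [hf.eventually_differentiableAt] with z hz
    exact (DFunLike.congr_fun (A.hasFDerivAt.comp z hz.hasFDerivAt).fderiv v).symm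

theorem mono {T : Submodule ℝ F} (hST : S ≤ T) (h : VanishesTo S m f) : VanishesTo T m f := by
  induction m generalizing f with
  | zero => exact hST h
  | succ m ih => exact ⟨h.1, fun v => ih (h.2 v)⟩

theorem top (h : VanishesTo S m f) : VanishesTo ⊤ m f := h.mono le_top

theorem of_succ {T : Submodule ℝ F} (h : VanishesTo T (m + 1) f) : VanishesTo S m f := by
  induction m generalizing f with
  | zero =>
    rw [VanishesTo, h.1]
    exact S.zero_mem
  | succ m ih => exact ⟨h.1, fun v => ih (h.2 v)⟩

theorem of_lt {T : Submodule ℝ F} {k : ℕ} (hmk : m < k) (h : VanishesTo T k f) :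
    VanishesTo S m f := by
  induction k, hmk using Nat.le_induction with
  | base => exact h.of_succ
  | succ k _ ih => exact ih h.of_succ

theorem of_le {T : Submodule ℝ F} {k : ℕ} (hmk : m ≤ k) (h : VanishesTo T k f) :
    VanishesTo (⊤ : Submodule ℝ F) m f :=
  hmk.eq_or_lt.elim (fun e => e ▸ h.top) fun hlt => h.of_lt hlt

theorem succ_of_bot (h : VanishesTo (⊥ : Submodule ℝ F) m f) :
    VanishesTo (⊤ : Submodule ℝ F) (m + 1) f := by
  induction m generalizing f with
  | zero => exact ⟨h, fun v => trivial⟩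
  | succ m ih => exact ⟨h.1, fun v => ih (h.2 v)⟩

theorem add [CompleteSpace F] (hf : AnalyticAt ℝ f 0) (hg : AnalyticAt ℝ g 0)
    (h : VanishesTo S m f) (h' : VanishesTo S m g) : VanishesTo S m fun z => f z + g z := by
  induction m generalizing f g with
  | zero => exact S.add_mem h h'
  | succ m ih =>
    refine ⟨by simp [h.1, h'.1], fun v =>
      (ih (hf.fderiv_apply v) (hg.fderiv_apply v) (h.2 v) (h'.2 v)).congr ?_⟩
    filter_upwards [hf.eventually_differentiableAt, hg.eventually_differentiableAt] with z hz hz'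
    rw [fderiv_fun_add hz hz']
    rfl

theorem const_smul [CompleteSpace F] (hf : AnalyticAt ℝ f 0) (c : ℝ) (h : VanishesTo S m f) :
    VanishesTo S m fun z => c • f z :=
  h.clm_comp hf (c • ContinuousLinearMap.id ℝ F) fun _ hx => S.smul_mem c hx

theorem neg [CompleteSpace F] (hf : AnalyticAt ℝ f 0) (h : VanishesTo S m f) :
    VanishesTo S m fun z => -f z :=
  h.clm_comp hf (-ContinuousLinearMap.id ℝ F) fun _ hx => S.neg_mem hx

theorem sub [CompleteSpace F] (hf : AnalyticAt ℝ f 0) (hg : AnalyticAt ℝ g 0)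
    (h : VanishesTo S m f) (h' : VanishesTo S m g) : VanishesTo S m fun z => f z - g z := by
  simpa only [sub_eq_add_neg] using! h.add hf hg.neg (h'.neg hg)

theorem sum [CompleteSpace F] {ι : Type*} (s : Finset ι) {f : ι → E → F}
    (hf : ∀ i, AnalyticAt ℝ (f i) 0) (h : ∀ i, VanishesTo S m (f i)) :
    VanishesTo S m fun z => ∑ i ∈ s, f i z := by
  classical
  induction s using Finset.induction_on with
  | empty => simpa using! (zero : VanishesTo S m (0 : E → F))
  | insert i s hi ih =>
    simp only [Finset.sum_insert hi]
    exact (h i).add (hf i) (Finset.analyticAt_fun_sum _ fun i _ => hf i) ih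

theorem bilin [CompleteSpace F] [CompleteSpace G] [CompleteSpace H] (B : F →L[ℝ] G →L[ℝ] H)
    {g : E → G} {a b : ℕ} (hf : AnalyticAt ℝ f 0) (hg : AnalyticAt ℝ g 0)
    (h : VanishesTo (⊤ : Submodule ℝ F) a f) (h' : VanishesTo (⊤ : Submodule ℝ G) b g) :
    VanishesTo (⊤ : Submodule ℝ H) (a + b) fun z => B (f z) (g z) := by
  obtain ⟨n, hn⟩ : ∃ n, a + b = n := ⟨_, rfl⟩
  rw [hn]
  induction n generalizing a b f g with
  | zero => trivial
  | succ n ih =>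
    have hdf (v : E) : AnalyticAt ℝ (fun z => B (fderiv ℝ f z v) (g z)) 0 :=
      (B.analyticAt_bilinear _).comp₂ (hf.fderiv_apply v) hg
    have hdg (v : E) : AnalyticAt ℝ (fun z => B (f z) (fderiv ℝ g z v)) 0 :=
      (B.analyticAt_bilinear _).comp₂ hf (hg.fderiv_apply v)
    have hl (v : E) : VanishesTo (⊤ : Submodule ℝ H) n fun z => B (fderiv ℝ f z v) (g z) := by
      cases a with
      | zero =>
        obtain ⟨b, rfl⟩ : ∃ b', b = b' + 1 := ⟨n, by omega⟩
        exact ih (a := 0) (hf.fderiv_apply v) hg trivial h'.of_succ (by omega)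
      | succ a => exact ih (hf.fderiv_apply v) hg (h.2 v) h' (by omega)
    have hr (v : E) : VanishesTo (⊤ : Submodule ℝ H) n fun z => B (f z) (fderiv ℝ g z v) := by
      cases b with
      | zero =>
        obtain ⟨a, rfl⟩ : ∃ a', a = a' + 1 := ⟨n, by omega⟩
        exact ih (b := 0) hf (hg.fderiv_apply v) h.of_succ trivial (by omega)
      | succ b => exact ih hf (hg.fderiv_apply v) h (h'.2 v) (by omega)
    refine ⟨?_, fun v => ((hl v).add (hdf v) (hdg v) (hr v)).congr ?_⟩
    · cases a with
      | zero =>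
        obtain ⟨b, rfl⟩ : ∃ b', b = b' + 1 := ⟨n, by omega⟩
        simp [h'.1]
      | succ a => simp [h.1]
    · filter_upwards [hf.eventually_differentiableAt, hg.eventually_differentiableAt] with z hz hz'
      rw [(B.hasFDerivAt_of_bilinear hz.hasFDerivAt hz'.hasFDerivAt).fderiv]
      simp [add_comm]

theorem smul [CompleteSpace F] {c : E → ℝ} {a b : ℕ} (hc : AnalyticAt ℝ c 0)
    (hf : AnalyticAt ℝ f 0) (h : VanishesTo (⊤ : Submodule ℝ ℝ) a c)
    (h' : VanishesTo (⊤ : Submodule ℝ F) b f) :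
    VanishesTo (⊤ : Submodule ℝ F) (a + b) fun z => c z • f z :=
  bilin (ContinuousLinearMap.lsmul ℝ ℝ) hc hf h h'

theorem clm_apply [CompleteSpace F] [CompleteSpace G] {A : E → F →L[ℝ] G} {a b : ℕ}
    (hA : AnalyticAt ℝ A 0)
    (hf : AnalyticAt ℝ f 0) (h : VanishesTo (⊤ : Submodule ℝ (F →L[ℝ] G)) a A)
    (h' : VanishesTo (⊤ : Submodule ℝ F) b f) :
    VanishesTo (⊤ : Submodule ℝ G) (a + b) fun z => A z (f z) :=
  bilin (ContinuousLinearMap.id ℝ (F →L[ℝ] G)) hA hf h h'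

theorem comp_clm [CompleteSpace F] {E' : Type*} [NormedAddCommGroup E'] [NormedSpace ℝ E']
    (A : E' →L[ℝ] E) (hf : AnalyticAt ℝ f 0) (h : VanishesTo S m f) :
    VanishesTo S m fun z => f (A z) := by
  induction m generalizing f with
  | zero => simpa [VanishesTo] using! h
  | succ m ih =>
    refine ⟨by simp [h.1], fun v => (ih (hf.fderiv_apply (A v)) (h.2 (A v))).congr ?_⟩
    have hA : Tendsto A (𝓝 0) (𝓝 0) := A.continuous.tendsto' _ _ A.map_zero
    filter_upwards [hA.eventually hf.eventually_differentiableAt] with z hz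
    exact (DFunLike.congr_fun (hz.hasFDerivAt.comp z A.hasFDerivAt).fderiv v).symm

/-- An analytic function all of whose derivatives vanish at `0` vanishes near `0`. -/
theorem eventually_eq_zero [CompleteSpace F] (hf : AnalyticAt ℝ f 0)
    (h : ∀ m, VanishesTo (⊤ : Submodule ℝ F) m f) : f =ᶠ[𝓝 0] 0 := by
  have key (m : ℕ) : ∀ f : E → F, AnalyticAt ℝ f 0 → VanishesTo (⊤ : Submodule ℝ F) (m + 1) f →
      iteratedFDeriv ℝ m f 0 = 0 := by
    induction m with
    | zero =>
      intro f _ h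
      ext v
      simpa using! h.1
    | succ m ih =>
      intro f hf h
      ext v
      rw [iteratedFDeriv_succ_apply_right]
      have h1 := ih _ (hf.fderiv_apply (v (Fin.last m))) (h.2 (v (Fin.last m)))
      have h2 := (ContinuousLinearMap.apply ℝ F (v (Fin.last m))).iteratedFDeriv_comp_left
        (hf.fderiv.contDiffAt (n := ⊤)) (i := m) (by exact_mod_cast le_top)
      have h3 := DFunLike.congr_fun (h2.symm.trans h1) (Fin.init v)
      simpa using! h3
  obtain ⟨p, r, hp⟩ := hf
  filter_upwards [eball_mem_nhds (0 : E) hp.r_pos] with z hz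
  have h1 := hp.hasSum_iteratedFDeriv (y := z) hz
  rw [zero_add] at h1
  refine h1.unique ?_
  simp [key _ f ⟨p, r, hp⟩ (h _)]

end VanishesTo
end Vanishing
section PlaneVanishing

open Filter Topology

variable {F : Type*} [NormedAddCommGroup F] [NormedSpace ℝ F]

theorem Complex.clm_apply_eq_partials (T : ℂ →L[ℝ] F) (v : ℂ) :
    T v = v.re • T 1 + v.im • T Complex.I := by
  rw [← map_smul, ← map_smul, ← map_add]
  congr 1
  simp

variable [CompleteSpace F] {S : Submodule ℝ F} {f : ℂ → F} {m : ℕ}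

namespace VanishesTo

theorem of_partial (hf : AnalyticAt ℝ f 0) (h0 : f 0 = 0)
    (hx : VanishesTo S m fun z => fderiv ℝ f z 1)
    (hy : VanishesTo S m fun z => fderiv ℝ f z Complex.I) : VanishesTo S (m + 1) f := by
  refine ⟨h0, fun v => ?_⟩
  have h := (hx.const_smul (hf.fderiv_apply 1) v.re).add
    ((hf.fderiv_apply 1).const_smul (c := v.re))
    ((hf.fderiv_apply Complex.I).const_smul (c := v.im))
    (hy.const_smul (hf.fderiv_apply Complex.I) v.im)
  exact h.congr (Eventually.of_forall fun z => (Complex.clm_apply_eq_partials _ v).symm)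

/-- A function solving a first order system to high order inherits vanishing from the real axis. -/
theorem of_real_axis (hf : AnalyticAt ℝ f 0) (A : F →L[ℝ] F) (hA : ∀ x ∈ S, A x ∈ S)
    (hr : VanishesTo S m fun t : ℝ => f t)
    (he : ∀ k, m = k + 1 →
      VanishesTo S k fun z => fderiv ℝ f z Complex.I - A (fderiv ℝ f z 1)) :
    VanishesTo S m f := by
  induction m generalizing f with
  | zero => simpa [VanishesTo] using hr
  | succ m ih =>
    have hfx := hf.fderiv_apply 1
    have hfy := hf.fderiv_apply Complex.I
    have hAx : AnalyticAt ℝ (fun z => A (fderiv ℝ f z 1)) 0 := (A.analyticAt _).comp hfx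
    have hx : VanishesTo S m fun z => fderiv ℝ f z 1 := by
      refine ih hfx ((hr.2 1).congr ?_) ?_
      · have ht : Tendsto (fun t : ℝ => (t : ℂ)) (𝓝 0) (𝓝 0) :=
          Complex.continuous_ofReal.tendsto' _ _ Complex.ofReal_zero
        filter_upwards [ht.eventually hf.eventually_differentiableAt] with t ht
        have := (ht.hasFDerivAt.comp t Complex.ofRealCLM.hasFDerivAt).fderiv
        exact (DFunLike.congr_fun this 1).trans (by simp)
      · rintro k rfl
        refine ((he _ rfl).2 1).congr ?_
        filter_upwards [hf.fderiv_fderiv_comm Complex.I 1, hfx.eventually_differentiableAt,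
          hfy.eventually_differentiableAt] with z hz hzx hzy
        have := (hzy.hasFDerivAt.sub (A.hasFDerivAt.comp z hzx.hasFDerivAt)).fderiv
        refine (DFunLike.congr_fun this 1).trans ?_
        rw [← hz]
        rfl
    refine of_partial hf ?_ hx ?_
    · simpa using hr.1
    · have h := (he _ rfl).add (hfy.sub hAx) hAx (hx.clm_comp hfx A hA)
      simpa using h

theorem re : VanishesTo (⊤ : Submodule ℝ ℝ) 1 Complex.re :=
  ⟨rfl, fun _ => trivial⟩

theorem im : VanishesTo (⊤ : Submodule ℝ ℝ) 1 Complex.im :=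
  ⟨rfl, fun _ => trivial⟩

theorem analyticAt_re (z : ℂ) : AnalyticAt ℝ Complex.re z := Complex.reCLM.analyticAt z

theorem analyticAt_im (z : ℂ) : AnalyticAt ℝ Complex.im z := Complex.imCLM.analyticAt z

/-- Euler's homogeneity relation for the leading part. -/
theorem euler (hf : AnalyticAt ℝ f 0) (h : VanishesTo (⊤ : Submodule ℝ F) m f) :
    VanishesTo (⊤ : Submodule ℝ F) (m + 1) fun z =>
      (m : ℝ) • f z - (z.re • fderiv ℝ f z 1 + z.im • fderiv ℝ f z Complex.I) := by
  have han {f : ℂ → F} (hf : AnalyticAt ℝ f 0) (c : ℝ) : AnalyticAt ℝ (fun z =>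
      c • f z - (z.re • fderiv ℝ f z 1 + z.im • fderiv ℝ f z Complex.I)) 0 :=
    hf.const_smul.sub (((analyticAt_re 0).smul (hf.fderiv_apply 1)).add
      ((analyticAt_im 0).smul (hf.fderiv_apply Complex.I)))
  have hz0 {f : ℂ → F} {m : ℕ} (h : VanishesTo (⊤ : Submodule ℝ F) m f) :
      (m : ℝ) • f 0 - ((0 : ℂ).re • fderiv ℝ f 0 1 + (0 : ℂ).im • fderiv ℝ f 0 Complex.I) = 0 := by
    cases m with
    | zero => simp
    | succ m => simp [h.1]
  induction m generalizing f with
  | zero => exact ⟨hz0 h, fun _ => trivial⟩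
  | succ m ih =>
    have hd (v : ℂ) : (fun z => (m : ℝ) • fderiv ℝ f z v -
        (z.re • fderiv ℝ (fun z => fderiv ℝ f z v) z 1 +
          z.im • fderiv ℝ (fun z => fderiv ℝ f z v) z Complex.I)) =ᶠ[𝓝 0]
        fun z => fderiv ℝ (fun z => ((m + 1 : ℕ) : ℝ) • f z -
          (z.re • fderiv ℝ f z 1 + z.im • fderiv ℝ f z Complex.I)) z v := by
      filter_upwards [hf.eventually_differentiableAt,
        (hf.fderiv_apply 1).eventually_differentiableAt,
        (hf.fderiv_apply Complex.I).eventually_differentiableAt,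
        hf.fderiv_fderiv_comm v 1, hf.fderiv_fderiv_comm v Complex.I] with z h0 hx hy h1 hI
      have h := (h0.hasFDerivAt.const_smul ((m + 1 : ℕ) : ℝ)).sub
        (((Complex.reCLM.hasFDerivAt (x := z)).smul hx.hasFDerivAt).add
          ((Complex.imCLM.hasFDerivAt (x := z)).smul hy.hasFDerivAt))
      refine Eq.trans ?_ (DFunLike.congr_fun h.fderiv v).symm
      rw [h1, hI]
      simp
      rw [add_smul, one_smul]
      nth_rewrite 3 [Complex.clm_apply_eq_partials (fderiv ℝ f z) v]
      module
    exact ⟨hz0 h, fun v => (ih (hf.fderiv_apply v) (h.2 v)).congr (hd v)⟩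

/-- If the leading part of `f` takes values in the span of `w`, it is a combination of the `w i` with
coefficients that factor through a curve tangent to the identity. -/
theorem exists_leading_combination {E : Type*} [NormedAddCommGroup E] [NormedSpace ℝ E]
    {γ : ℂ → E} (hγ : AnalyticAt ℝ γ 0) {Λ : E →L[ℝ] ℂ}
    (hΛ : VanishesTo (⊤ : Submodule ℝ ℂ) 2 fun z => Λ (γ z) - z) {ι : Type*} [Fintype ι]
    (w : ι → F) (hf : AnalyticAt ℝ f 0) (h : VanishesTo (Submodule.span ℝ (Set.range w)) m f) :
    ∃ a : ι → E → ℝ, (∀ i p, AnalyticAt ℝ (a i) p) ∧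
      (∀ i, VanishesTo (⊤ : Submodule ℝ ℝ) m fun z => a i (γ z)) ∧
      VanishesTo (⊤ : Submodule ℝ F) (m + 1) fun z => f z - ∑ i, a i (γ z) • w i := by
  induction m generalizing f with
  | zero =>
    obtain ⟨c, hc⟩ := (Submodule.mem_span_range_iff_exists_fun ℝ).1 h
    exact ⟨fun i _ => c i, fun i p => analyticAt_const, fun _ => trivial,
      by simp [hc], fun _ => trivial⟩
  | succ m ih =>
    have hfx := hf.fderiv_apply 1
    have hfy := hf.fderiv_apply Complex.I
    obtain ⟨a, ha, ham, hav⟩ := ih hfx (h.2 1)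
    obtain ⟨b, hb, hbm, hbv⟩ := ih hfy (h.2 Complex.I)
    have hre : ∀ p, AnalyticAt ℝ (fun p => (Λ p).re) p := fun p =>
      (Complex.reCLM.comp Λ).analyticAt p
    have him : ∀ p, AnalyticAt ℝ (fun p => (Λ p).im) p := fun p =>
      (Complex.imCLM.comp Λ).analyticAt p
    have hΛan : AnalyticAt ℝ (fun z => Λ (γ z) - z) 0 :=
      ((Λ.analyticAt _).comp hγ).sub analyticAt_id
    have hdre : AnalyticAt ℝ (fun z => (Λ (γ z) - z).re) 0 := (Complex.reCLM.analyticAt _).comp hΛan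
    have hdim : AnalyticAt ℝ (fun z => (Λ (γ z) - z).im) 0 := (Complex.imCLM.analyticAt _).comp hΛan
    have hdrev : VanishesTo (⊤ : Submodule ℝ ℝ) 2 fun z => (Λ (γ z) - z).re :=
      hΛ.clm_comp hΛan Complex.reCLM fun _ _ => trivial
    have hdimv : VanishesTo (⊤ : Submodule ℝ ℝ) 2 fun z => (Λ (γ z) - z).im :=
      hΛ.clm_comp hΛan Complex.imCLM fun _ _ => trivial
    have haγ (i) : AnalyticAt ℝ (fun z => a i (γ z)) 0 := (ha i _).comp hγ
    have hbγ (i) : AnalyticAt ℝ (fun z => b i (γ z)) 0 := (hb i _).comp hγ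
    set c : ℝ := ((m + 1 : ℕ) : ℝ)⁻¹ with hc
    have hc1 : c * ((m + 1 : ℕ) : ℝ) = 1 := inv_mul_cancel₀ (by positivity)
    -- the exact coefficients along the curve, and their homogeneous model
    have hcoef (i) : AnalyticAt ℝ (fun z => (Λ (γ z) - z).re * a i (γ z) +
        (Λ (γ z) - z).im * b i (γ z)) 0 := (hdre.mul (haγ i)).add (hdim.mul (hbγ i))
    have hcoefv (i) : VanishesTo (⊤ : Submodule ℝ ℝ) (m + 2) fun z =>
        (Λ (γ z) - z).re * a i (γ z) + (Λ (γ z) - z).im * b i (γ z) := by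
      rw [add_comm]
      exact (hdrev.smul hdre (haγ i) (ham i)).add (hdre.mul (haγ i)) (hdim.mul (hbγ i))
        (hdimv.smul hdim (hbγ i) (hbm i))
    have hmain (i) : AnalyticAt ℝ (fun z => z.re * a i (γ z) + z.im * b i (γ z)) 0 :=
      ((analyticAt_re 0).mul (haγ i)).add ((analyticAt_im 0).mul (hbγ i))
    have hmainv (i) : VanishesTo (⊤ : Submodule ℝ ℝ) (m + 1) fun z =>
        z.re * a i (γ z) + z.im * b i (γ z) := by
      rw [add_comm]
      exact (re.smul (analyticAt_re 0) (haγ i) (ham i)).add ((analyticAt_re 0).mul (haγ i))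
        ((analyticAt_im 0).mul (hbγ i)) (im.smul (analyticAt_im 0) (hbγ i) (hbm i))
    refine ⟨fun i p => c * ((Λ p).re * a i p + (Λ p).im * b i p), fun i p =>
      analyticAt_const.mul (((hre p).mul (ha i p)).add ((him p).mul (hb i p))), fun i => ?_, ?_⟩
    · refine (((hmainv i).add (hmain i) (hcoef i) (hcoefv i).of_succ).const_smul
        ((hmain i).add (hcoef i)) c).congr (Eventually.of_forall fun z => ?_)
      simp only [Pi.add_apply, smul_eq_mul, Complex.sub_re, Complex.sub_im]
      ring
    · have hg {g : ι → ℂ → ℝ} (hg : ∀ i, AnalyticAt ℝ (g i) 0) :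
          AnalyticAt ℝ (fun z => ∑ i, g i z • w i) 0 :=
        Finset.analyticAt_fun_sum _ fun i _ => (hg i).smul analyticAt_const
      have hrx := hfx.sub (hg haγ)
      have hry := hfy.sub (hg hbγ)
      have hmul : AnalyticAt ℝ (fun z : ℂ => z.re • (fderiv ℝ f z 1 - ∑ i, a i (γ z) • w i) +
          z.im • (fderiv ℝ f z Complex.I - ∑ i, b i (γ z) • w i)) 0 :=
        ((analyticAt_re 0).smul hrx).add ((analyticAt_im 0).smul hry)
      have hmulv : VanishesTo (⊤ : Submodule ℝ F) (m + 2) fun z : ℂ =>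
          z.re • (fderiv ℝ f z 1 - ∑ i, a i (γ z) • w i) +
          z.im • (fderiv ℝ f z Complex.I - ∑ i, b i (γ z) • w i) := by
        rw [show m + 2 = 1 + (m + 1) by ring]
        exact (re.smul (analyticAt_re 0) hrx hav).add ((analyticAt_re 0).smul hrx)
          ((analyticAt_im 0).smul hry) (im.smul (analyticAt_im 0) hry hbv)
      have hcw : VanishesTo (⊤ : Submodule ℝ F) (m + 2) fun z => ∑ i,
          ((Λ (γ z) - z).re * a i (γ z) + (Λ (γ z) - z).im * b i (γ z)) • w i :=
        sum _ (fun i => (hcoef i).smul analyticAt_const) fun i =>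
          (hcoefv i).smul (b := 0) (hcoef i) analyticAt_const trivial
      have heu : AnalyticAt ℝ (fun z : ℂ => ((m + 1 : ℕ) : ℝ) • f z -
          (z.re • fderiv ℝ f z 1 + z.im • fderiv ℝ f z Complex.I)) 0 :=
        hf.const_smul.sub (((analyticAt_re 0).smul hfx).add ((analyticAt_im 0).smul hfy))
      refine ((((euler hf h.top).add heu hmul hmulv).sub (heu.add hmul) (hg hcoef)
        hcw).const_smul ((heu.add hmul).sub (hg hcoef)) c).congr (Eventually.of_forall fun z => ?_)
      simp only [Pi.add_apply, Pi.sub_apply, smul_sub, smul_add, smul_smul, Finset.smul_sum, hc1,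
        one_smul]
      have hsplit : ∑ i, (c * ((Λ (γ z)).re * a i (γ z) + (Λ (γ z)).im * b i (γ z))) • w i =
          ∑ i, (c * z.re * a i (γ z)) • w i + ∑ i, (c * z.im * b i (γ z)) • w i +
          ∑ i, (c * ((Λ (γ z) - z).re * a i (γ z) + (Λ (γ z) - z).im * b i (γ z))) • w i := by
        rw [← Finset.sum_add_distrib, ← Finset.sum_add_distrib]
        refine Finset.sum_congr rfl fun i _ => ?_
        rw [← add_smul, ← add_smul]
        congr 1
        simp only [Complex.sub_re, Complex.sub_im]
        ring
      rw [hsplit]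
      simp only [mul_assoc]
      abel

end VanishesTo
end PlaneVanishing
section BracketsAlongCurve

open Filter Topology

variable {F : Type*} [NormedAddCommGroup F] [NormedSpace ℝ F]

theorem nestedLie_append (l : List (F → F)) (Y Z : F → F) :
    nestedLie (l ++ [Y]) Z = nestedLie l (lieVF Y Z) := by
  induction l with
  | nil => rfl
  | cons W l ih => exact congrArg (lieVF W) ih

theorem analyticAt_comp_of_zero {γ : ℂ → F} {G : Type*} [NormedAddCommGroup G] [NormedSpace ℝ G]
    {g : F → G} (hg : AnalyticAt ℝ g 0) (hγ : AnalyticAt ℝ γ 0) (hγ0 : γ 0 = 0) :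
    AnalyticAt ℝ (fun z => g (γ z)) 0 :=
  hg.comp_of_eq hγ hγ0

theorem eventually_comp_of_zero {γ : ℂ → F} {P : F → Prop} (hP : ∀ᶠ p in 𝓝 0, P p) (hγ : AnalyticAt ℝ γ 0)
    (hγ0 : γ 0 = 0) : ∀ᶠ z in 𝓝 0, P (γ z) :=
  hγ.continuousAt.eventually (hγ0.symm ▸ hP)

variable [CompleteSpace F]

theorem AnalyticAt.lieVF {X Y : F → F} {p : F} (hX : AnalyticAt ℝ X p) (hY : AnalyticAt ℝ Y p) :
    AnalyticAt ℝ (lieVF X Y) p :=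
  (hY.fderiv.clm_apply hX).sub (hX.fderiv.clm_apply hY)

theorem AnalyticAt.nestedLie {l : List (F → F)} {Z : F → F} {p : F}
    (hl : ∀ Y ∈ l, AnalyticAt ℝ Y p) (hZ : AnalyticAt ℝ Z p) : AnalyticAt ℝ (nestedLie l Z) p := by
  induction l with
  | nil => exact hZ
  | cons Y l ih =>
    exact (hl Y (by simp)).lieVF (ih fun W hW => hl W (by simp [hW]))

/-- The coordinate directions `1` and `I` of the parameter plane. -/
def axisDir (b : Bool) : ℂ := if b then 1 else Complex.I

/-- The failure of `γ` to have the coordinate derivatives prescribed by `Y`. -/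
def tangencyError (γ : ℂ → F) (Y : Bool → F → F) (b : Bool) (z : ℂ) : F :=
  fderiv ℝ γ z (axisDir b) - Y b (γ z)

variable {γ : ℂ → F} {Y : Bool → F → F}

theorem fderiv_comp_eventuallyEq {G : Type*} [NormedAddCommGroup G] [NormedSpace ℝ G]
    [CompleteSpace G] {g : F → G} (hg : AnalyticAt ℝ g 0) (hγ : AnalyticAt ℝ γ 0)
    (hγ0 : γ 0 = 0) (v : ℂ) :
    (fun z => fderiv ℝ (fun z => g (γ z)) z v) =ᶠ[𝓝 0]
      fun z => fderiv ℝ g (γ z) (fderiv ℝ γ z v) := by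
  filter_upwards [eventually_comp_of_zero hg.eventually_differentiableAt hγ hγ0,
    hγ.eventually_differentiableAt] with z hz hz'
  exact DFunLike.congr_fun (hz.hasFDerivAt.comp z hz'.hasFDerivAt).fderiv v

theorem analyticAt_tangencyError (hγ : AnalyticAt ℝ γ 0) (hγ0 : γ 0 = 0)
    (hY : ∀ b, AnalyticAt ℝ (Y b) 0) (b : Bool) : AnalyticAt ℝ (tangencyError γ Y b) 0 :=
  (hγ.fderiv_apply _).sub (analyticAt_comp_of_zero (hY b) hγ hγ0)

theorem lieVF_comp_eventuallyEq (hγ : AnalyticAt ℝ γ 0) (hγ0 : γ 0 = 0) {G : F → F}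
    (hG : AnalyticAt ℝ G 0) (b : Bool) :
    (fun z => lieVF (Y b) G (γ z)) =ᶠ[𝓝 0] fun z =>
      fderiv ℝ (fun z => G (γ z)) z (axisDir b) - fderiv ℝ G (γ z) (tangencyError γ Y b z) -
        fderiv ℝ (Y b) (γ z) (G (γ z)) := by
  filter_upwards [fderiv_comp_eventuallyEq hG hγ hγ0 (axisDir b)] with z hz
  rw [hz]
  simp [lieVF, tangencyError]

theorem lieVF_comp_eq_tangencyError (hγ : AnalyticAt ℝ γ 0) (hγ0 : γ 0 = 0)
    (hY : ∀ b, AnalyticAt ℝ (Y b) 0) (b c : Bool) :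
    (fun z => lieVF (Y b) (Y c) (γ z)) =ᶠ[𝓝 0] fun z =>
      fderiv ℝ (tangencyError γ Y b) z (axisDir c) - fderiv ℝ (tangencyError γ Y c) z (axisDir b) +
        (fderiv ℝ (Y b) (γ z) (tangencyError γ Y c z) -
          fderiv ℝ (Y c) (γ z) (tangencyError γ Y b z)) := by
  have hd (b c : Bool) : ∀ᶠ z in 𝓝 0, fderiv ℝ (tangencyError γ Y b) z (axisDir c) =
      fderiv ℝ (fun z => fderiv ℝ γ z (axisDir b)) z (axisDir c) -
        fderiv ℝ (Y b) (γ z) (fderiv ℝ γ z (axisDir c)) := by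
    filter_upwards [fderiv_comp_eventuallyEq (hY b) hγ hγ0 (axisDir c),
      (hγ.fderiv_apply (axisDir b)).eventually_differentiableAt,
      (analyticAt_comp_of_zero (hY b) hγ hγ0).eventually_differentiableAt] with z hz h1 h2
    rw [← hz]
    exact DFunLike.congr_fun (h1.hasFDerivAt.sub h2.hasFDerivAt).fderiv _
  filter_upwards [hd b c, hd c b, hγ.fderiv_fderiv_comm (axisDir b) (axisDir c)] with z h1 h2 h3
  rw [h1, h2, h3]
  simp only [lieVF, tangencyError, map_sub]
  abel

variable {N : ℕ}

theorem vanishesTo_fderiv_comp_apply {H : Type*} [NormedAddCommGroup H] [NormedSpace ℝ H]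
    [CompleteSpace H] {G : F → H} (hG : AnalyticAt ℝ G 0)
    (hγ : AnalyticAt ℝ γ 0) (hγ0 : γ 0 = 0) {f : ℂ → F} (hf : AnalyticAt ℝ f 0)
    (h : VanishesTo (⊤ : Submodule ℝ F) N f) :
    VanishesTo (⊤ : Submodule ℝ H) N fun z => fderiv ℝ G (γ z) (f z) := by
  simpa using VanishesTo.clm_apply (a := 0) (analyticAt_comp_of_zero hG.fderiv hγ hγ0) hf trivial h

/-- Vanishing of the iterated brackets of `G` at `0` forces vanishing of `G` along `γ`. -/
theorem vanishesTo_of_nestedLie (hγ : AnalyticAt ℝ γ 0) (hγ0 : γ 0 = 0)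
    (hY : ∀ b, AnalyticAt ℝ (Y b) 0)
    (hR : ∀ b, VanishesTo (⊤ : Submodule ℝ F) N (tangencyError γ Y b)) {m : ℕ} (hm : m ≤ N)
    {S : Submodule ℝ F} {G : F → F} (hG : AnalyticAt ℝ G 0)
    (hlt : ∀ l : List Bool, l.length < m → nestedLie (l.map Y) G 0 = 0)
    (heq : ∀ l : List Bool, l.length = m → nestedLie (l.map Y) G 0 ∈ S) :
    VanishesTo S m fun z => G (γ z) := by
  induction m generalizing S G with
  | zero => simpa [VanishesTo, hγ0] using! heq [] rfl
  | succ m ih =>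
    have hGγ := analyticAt_comp_of_zero hG hγ hγ0
    have hbot : VanishesTo (⊤ : Submodule ℝ F) (m + 1) fun z => G (γ z) :=
      (ih (S := ⊥) (by omega) hG (fun l hl => hlt l (by omega))
        fun l hl => hlt l (by omega)).succ_of_bot
    have hd (b : Bool) : VanishesTo S m fun z => fderiv ℝ (fun z => G (γ z)) z (axisDir b) := by
      have hL := (hY b).lieVF hG
      have hR' := analyticAt_tangencyError hγ hγ0 hY b
      have h1 : VanishesTo S m fun z => lieVF (Y b) G (γ z) := by
        refine ih (by omega) hL (fun l hl => ?_) fun l hl => ?_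
        · simpa [nestedLie_append] using hlt (l ++ [b]) (by simpa using hl)
        · simpa [nestedLie_append] using heq (l ++ [b]) (by simpa using hl)
      have h2 := (vanishesTo_fderiv_comp_apply hG hγ hγ0 hR' (hR b)).of_lt (S := S) (m := m) hm
      have h3 := (vanishesTo_fderiv_comp_apply (hY b) hγ hγ0 hGγ hbot).of_succ (S := S)
      have a1 := analyticAt_comp_of_zero hL hγ hγ0
      have a2 := (analyticAt_comp_of_zero hG.fderiv hγ hγ0).clm_apply hR'
      have a3 := (analyticAt_comp_of_zero (hY b).fderiv hγ hγ0).clm_apply hGγ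
      refine ((h1.add a1 a2 h2).add (a1.add a2) a3 h3).congr ?_
      filter_upwards [lieVF_comp_eventuallyEq (Y := Y) hγ hγ0 hG b] with z hz
      rw [Pi.add_apply, hz]
      abel
    exact VanishesTo.of_partial hGγ (by simpa [hγ0] using! hlt [] (by simp)) (hd true) (hd false)

theorem vanishesTo_lieVF (hγ : AnalyticAt ℝ γ 0) (hγ0 : γ 0 = 0)
    (hY : ∀ b, AnalyticAt ℝ (Y b) 0)
    (hR : ∀ b, VanishesTo (⊤ : Submodule ℝ F) (N + 1) (tangencyError γ Y b)) (b c : Bool) :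
    VanishesTo (⊤ : Submodule ℝ F) N fun z => lieVF (Y b) (Y c) (γ z) := by
  have hR' := analyticAt_tangencyError hγ hγ0 hY
  have h2 (b c) := (vanishesTo_fderiv_comp_apply (hY b) hγ hγ0 (hR' c) (hR c)).of_succ
    (S := (⊤ : Submodule ℝ F))
  have a2 (b c) := (analyticAt_comp_of_zero (hY b).fderiv hγ hγ0).clm_apply (hR' c)
  have a1 (b c) := (hR' b).fderiv_apply (axisDir c)
  exact ((((hR b).2 (axisDir c)).sub (a1 b c) (a1 c b) ((hR c).2 (axisDir b))).add
    ((a1 b c).sub (a1 c b)) ((a2 b c).sub (a2 c b)) ((h2 b c).sub (a2 b c) (a2 c b) (h2 c b))).congr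
    (lieVF_comp_eq_tangencyError hγ hγ0 hY b c).symm

theorem analyticAt_nestedLie_map (hY : ∀ b, AnalyticAt ℝ (Y b) 0) (l : List Bool) (c : Bool) :
    AnalyticAt ℝ (nestedLie (l.map Y) (Y c)) 0 :=
  .nestedLie (fun W hW => by
    obtain ⟨b, -, rfl⟩ := List.mem_map.1 hW
    exact hY b) (hY c)

theorem vanishesTo_nestedLie (hγ : AnalyticAt ℝ γ 0) (hγ0 : γ 0 = 0)
    (hY : ∀ b, AnalyticAt ℝ (Y b) 0)
    (hR : ∀ b, VanishesTo (⊤ : Submodule ℝ F) N (tangencyError γ Y b)) (b c : Bool)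
    (l : List Bool) {k : ℕ} (hk : l.length + 1 + k = N) :
    VanishesTo (⊤ : Submodule ℝ F) k fun z => nestedLie ((b :: l).map Y) (Y c) (γ z) := by
  induction l generalizing b k with
  | nil =>
    obtain rfl : N = k + 1 := by simpa [add_comm] using hk.symm
    exact vanishesTo_lieVF hγ hγ0 hY hR b c
  | cons d l ih =>
    have hG := analyticAt_nestedLie_map hY (d :: l) c
    have hGγ := analyticAt_comp_of_zero hG hγ hγ0
    have hR' := analyticAt_tangencyError hγ hγ0 hY b
    have h1 := ih d (k := k + 1) (by simp at hk ⊢; omega)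
    have h2 := (vanishesTo_fderiv_comp_apply hG hγ hγ0 hR' (hR b)).of_lt
      (S := (⊤ : Submodule ℝ F)) (m := k) (by omega)
    have h3 := (vanishesTo_fderiv_comp_apply (hY b) hγ hγ0 hGγ h1).of_succ
      (S := (⊤ : Submodule ℝ F))
    have a1 := hGγ.fderiv_apply (axisDir b)
    have a2 := (analyticAt_comp_of_zero hG.fderiv hγ hγ0).clm_apply hR'
    have a3 := (analyticAt_comp_of_zero (hY b).fderiv hγ hγ0).clm_apply hGγ
    exact (((h1.2 (axisDir b)).sub a1 a2 h2).sub (a1.sub a2) a3 h3).congr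
      (lieVF_comp_eventuallyEq hγ hγ0 hG b).symm

theorem nestedLie_eq_zero_of_vanishesTo (hγ : AnalyticAt ℝ γ 0) (hγ0 : γ 0 = 0)
    (hY : ∀ b, AnalyticAt ℝ (Y b) 0)
    (hR : ∀ b, VanishesTo (⊤ : Submodule ℝ F) N (tangencyError γ Y b)) (b c : Bool)
    (l : List Bool) (hl : l.length + 1 < N) : nestedLie ((b :: l).map Y) (Y c) 0 = 0 := by
  obtain ⟨k, hk⟩ : ∃ k, l.length + 1 + (k + 1) = N := ⟨N - (l.length + 2), by omega⟩
  have := (vanishesTo_nestedLie hγ hγ0 hY hR b c l hk).1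
  simpa [hγ0] using! this

/-- If the brackets of length `N + 1` at `0` lie in `S`, the error `tangencyError γ Y true` satisfies
the linearized Cauchy-Riemann equation modulo `S`. -/
theorem vanishesTo_cauchyRiemann (hγ : AnalyticAt ℝ γ 0) (hγ0 : γ 0 = 0)
    (hY : ∀ b, AnalyticAt ℝ (Y b) 0)
    (hR : ∀ b, VanishesTo (⊤ : Submodule ℝ F) (N + 1) (tangencyError γ Y b)) {S : Submodule ℝ F}
    (hS : ∀ l : List Bool, l.length = N + 1 → ∀ c, nestedLie (l.map Y) (Y c) 0 ∈ S)
    (A : F →L[ℝ] F)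
    (hA : VanishesTo (⊤ : Submodule ℝ F) (N + 2)
      fun z => tangencyError γ Y false z - A (tangencyError γ Y true z)) :
    VanishesTo S N fun z => fderiv ℝ (tangencyError γ Y true) z Complex.I -
      A (fderiv ℝ (tangencyError γ Y true) z 1) := by
  have hR' := analyticAt_tangencyError hγ hγ0 hY
  have hW : AnalyticAt ℝ (lieVF (Y true) (Y false)) 0 := (hY true).lieVF (hY false)
  have h1 : VanishesTo S N fun z => lieVF (Y true) (Y false) (γ z) := by
    refine vanishesTo_of_nestedLie hγ hγ0 hY hR (by omega) hW (fun l hl => ?_) fun l hl => ?_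
    · rw [← nestedLie_append]
      obtain ⟨b, l', hb⟩ := List.exists_cons_of_ne_nil (l := l ++ [true]) (by simp)
      have hl' := congrArg List.length hb
      simp only [List.length_append, List.length_cons, List.length_nil] at hl'
      rw [show List.map Y l ++ [Y true] = (b :: l').map Y by simp [← hb]]
      exact nestedLie_eq_zero_of_vanishesTo hγ hγ0 hY hR b false l' (by omega)
    · rw [← nestedLie_append]
      simpa using hS (l ++ [true]) (by simpa using hl) false
  have aA : AnalyticAt ℝ (fun z => tangencyError γ Y false z - A (tangencyError γ Y true z)) 0 :=
    (hR' false).sub ((A.analyticAt _).comp (hR' true))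
  have a1 := analyticAt_comp_of_zero hW hγ hγ0
  have a2 := aA.fderiv_apply 1
  have h2 := (hA.2 1).of_succ (S := S)
  have a3 (b c) := (analyticAt_comp_of_zero (hY b).fderiv hγ hγ0).clm_apply (hR' c)
  have h3 (b c) := (vanishesTo_fderiv_comp_apply (hY b) hγ hγ0 (hR' c) (hR c)).of_succ (S := S)
  refine (((h1.add a1 a2 h2).add (a1.add a2) (a3 false true) (h3 false true)).sub
    ((a1.add a2).add (a3 false true)) (a3 true false) (h3 true false)).congr ?_
  filter_upwards [lieVF_comp_eq_tangencyError hγ hγ0 hY true false,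
    (hR' true).eventually_differentiableAt, (hR' false).eventually_differentiableAt] with z hz ht hf
  have := DFunLike.congr_fun
    (hf.hasFDerivAt.sub (A.hasFDerivAt.comp z ht.hasFDerivAt)).fderiv 1
  replace this : fderiv ℝ (fun z => tangencyError γ Y false z - A (tangencyError γ Y true z)) z 1 =
    fderiv ℝ (tangencyError γ Y false) z 1 - A (fderiv ℝ (tangencyError γ Y true) z 1) := this
  simp only [Pi.add_apply, hz, this, axisDir]
  simp
  abel

end BracketsAlongCurve
section Frames

open Filter Topology

variable {E F : Type*} [NormedAddCommGroup E] [NormedSpace ℝ E] [NormedAddCommGroup F]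
  [NormedSpace ℝ F] {ι : Type*} [Fintype ι]

/-- The combination of the frame `M` with coefficient functions `a`. -/
def frameComb (M : ι → F → F) (a : ι → F → ℝ) : F → F := fun p => ∑ i, a i p • M i p

theorem AnalyticAt.frameComb {M : ι → F → F} {a : ι → F → ℝ} {p : F}
    (hM : ∀ i, AnalyticAt ℝ (M i) p) (ha : ∀ i, AnalyticAt ℝ (a i) p) :
    AnalyticAt ℝ (frameComb M a) p :=
  Finset.analyticAt_fun_sum _ fun i _ => (ha i).smul (hM i)

theorem frameComb_add (M : ι → F → F) (a b : ι → F → ℝ) (p : F) :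
    frameComb M (fun i p => a i p + b i p) p = frameComb M a p + frameComb M b p := by
  simp [frameComb, add_smul, Finset.sum_add_distrib]

theorem LinearIndependent.exists_dual_clm [FiniteDimensional ℝ F] {w : ι → F}
    (hw : LinearIndependent ℝ w) : ∃ g : F →L[ℝ] (ι → ℝ), ∀ u : ι → ℝ, g (∑ i, u i • w i) = u := by
  obtain ⟨g, hg⟩ := (Fintype.linearCombination ℝ w).exists_leftInverse_of_injective
    (LinearMap.ker_eq_bot.2 hw.fintypeLinearCombination_injective)
  exact ⟨g.toContinuousLinearMap, fun u => LinearMap.congr_fun hg u⟩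

namespace VanishesTo

theorem sum_smul_const [FiniteDimensional ℝ F] {u : ι → E → ℝ} {w : ι → F} {m : ℕ}
    (hu : ∀ i, AnalyticAt ℝ (u i) 0) (h : ∀ i, VanishesTo (⊤ : Submodule ℝ ℝ) m (u i)) :
    VanishesTo (Submodule.span ℝ (Set.range w)) m fun z => ∑ i, u i z • w i := by
  have := FiniteDimensional.complete ℝ F
  exact sum _ (fun i => (hu i).smul analyticAt_const) fun i =>
    (h i).clm_comp (hu i) (ContinuousLinearMap.toSpanSingleton ℝ (w i)) fun c _ =>
      Submodule.smul_mem _ c (Submodule.subset_span ⟨i, rfl⟩)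

theorem sum_smul_sub_const [FiniteDimensional ℝ F] {u : ι → E → ℝ} {v : ι → E → F} {m : ℕ}
    (hu : ∀ i, AnalyticAt ℝ (u i) 0) (hv : ∀ i, AnalyticAt ℝ (v i) 0)
    (h : ∀ i, VanishesTo (⊤ : Submodule ℝ ℝ) m (u i)) :
    VanishesTo (⊤ : Submodule ℝ F) (m + 1) fun z => ∑ i, u i z • (v i z - v i 0) := by
  have := FiniteDimensional.complete ℝ F
  have hd (i) : AnalyticAt ℝ (fun z => v i z - v i 0) 0 := (hv i).sub analyticAt_const
  exact sum _ (fun i => (hu i).smul (hd i)) fun i =>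
    (h i).smul (hu i) (hd i) ⟨sub_self _, fun _ => trivial⟩

theorem coeff_of_sum_smul [FiniteDimensional ℝ F] {u : ι → E → ℝ} {v : ι → E → F} {m : ℕ}
    (hu : ∀ i, AnalyticAt ℝ (u i) 0) (hv : ∀ i, AnalyticAt ℝ (v i) 0)
    (hli : LinearIndependent ℝ fun i => v i 0)
    (h : VanishesTo (⊤ : Submodule ℝ F) m fun z => ∑ i, u i z • v i z) (i : ι) :
    VanishesTo (⊤ : Submodule ℝ ℝ) m (u i) := by
  have := FiniteDimensional.complete ℝ F
  obtain ⟨g, hg⟩ := hli.exists_dual_clm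
  induction m generalizing i with
  | zero => trivial
  | succ m ih =>
    have hd (i) : AnalyticAt ℝ (fun z => v i z - v i 0) 0 := (hv i).sub analyticAt_const
    have a1 : AnalyticAt ℝ (fun z => ∑ i, u i z • v i z) 0 :=
      Finset.analyticAt_fun_sum _ fun i _ => (hu i).smul (hv i)
    have a2 : AnalyticAt ℝ (fun z => ∑ i, u i z • (v i z - v i 0)) 0 :=
      Finset.analyticAt_fun_sum _ fun i _ => (hu i).smul (hd i)
    have h1 := h.sub a1 a2 (sum_smul_sub_const hu hv (ih h.of_succ))
    refine (h1.clm_comp (a1.sub a2) ((ContinuousLinearMap.proj i).comp g) (T := ⊤)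
      fun _ _ => trivial).congr
      (Eventually.of_forall fun z => ?_)
    have : (∑ i, u i z • v i z) - ∑ i, u i z • (v i z - v i 0) = ∑ i, u i z • v i 0 := by
      rw [← Finset.sum_sub_distrib]
      simp [smul_sub]
    simp only [Pi.sub_apply, this]
    exact congrFun (hg fun i => u i z) i

theorem span_of_sum_smul [FiniteDimensional ℝ F] {u : ι → E → ℝ} {v : ι → E → F} {m : ℕ}
    (hu : ∀ i, AnalyticAt ℝ (u i) 0) (hv : ∀ i, AnalyticAt ℝ (v i) 0)
    (hli : LinearIndependent ℝ fun i => v i 0)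
    (h : VanishesTo (⊤ : Submodule ℝ F) m fun z => ∑ i, u i z • v i z) :
    VanishesTo (Submodule.span ℝ (Set.range fun i => v i 0)) m fun z => ∑ i, u i z • v i z := by
  have := FiniteDimensional.complete ℝ F
  have hu' := coeff_of_sum_smul hu hv hli h
  refine ((sum_smul_const hu hu').add
    (Finset.analyticAt_fun_sum _ fun i _ => (hu i).smul analyticAt_const)
    (Finset.analyticAt_fun_sum _ fun i _ => (hu i).smul ((hv i).sub analyticAt_const))
    (sum_smul_sub_const hu hv hu').of_succ).congr (Eventually.of_forall fun z => ?_)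
  simp only
  rw [← Finset.sum_add_distrib]
  simp [smul_sub]

end VanishesTo

variable {J : F → F →L[ℝ] F} {M : ι → F → F} {γ : ℂ → F}

theorem tangencyError_false {X : F → F}
    (hol : ∀ᶠ z in 𝓝 0, fderiv ℝ γ z Complex.I = J (γ z) (fderiv ℝ γ z 1)) :
    (fun z => J (γ z) (tangencyError γ (pickVF X (Jvf J X)) true z)) =ᶠ[𝓝 0]
      tangencyError γ (pickVF X (Jvf J X)) false := by
  filter_upwards [hol] with z hz
  simp [tangencyError, axisDir, pickVF, Jvf, hz]

theorem vanishesTo_tangencyError [CompleteSpace F] {X : F → F} (hJ : AnalyticAt ℝ J 0)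
    (hX : AnalyticAt ℝ X 0) (hγ : AnalyticAt ℝ γ 0) (hγ0 : γ 0 = 0)
    (hol : ∀ᶠ z in 𝓝 0, fderiv ℝ γ z Complex.I = J (γ z) (fderiv ℝ γ z 1)) {N : ℕ}
    (hN : VanishesTo (⊤ : Submodule ℝ F) N fun z => fderiv ℝ γ z 1 - X (γ z)) :
    ∀ b, VanishesTo (⊤ : Submodule ℝ F) N (tangencyError γ (pickVF X (Jvf J X)) b)
  | true => hN
  | false => by
    have h := VanishesTo.clm_apply (a := 0) (analyticAt_comp_of_zero hJ hγ hγ0)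
      ((hγ.fderiv_apply 1).sub (analyticAt_comp_of_zero hX hγ hγ0)) trivial hN
    rw [zero_add] at h
    exact h.congr (tangencyError_false hol)

/-- The leading part of the error of a frame combination takes values in the span of the frame. -/
theorem vanishesTo_span_of_commuting [FiniteDimensional ℝ F]
    (hJ : AnalyticAt ℝ J 0) (hM : ∀ i, AnalyticAt ℝ (M i) 0)
    (hli : LinearIndependent ℝ fun i => M i 0)
    (hJM : ∀ x ∈ Submodule.span ℝ (Set.range fun i => M i 0),
      J 0 x ∈ Submodule.span ℝ (Set.range fun i => M i 0))
    (hγ : AnalyticAt ℝ γ 0) (hγ0 : γ 0 = 0)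
    (hol : ∀ᶠ z in 𝓝 0, fderiv ℝ γ z Complex.I = J (γ z) (fderiv ℝ γ z 1))
    {a₀ a : ι → F → ℝ} (ha₀ : ∀ i, AnalyticAt ℝ (a₀ i) 0) (ha : ∀ i, AnalyticAt ℝ (a i) 0)
    (hreal : ∀ᶠ t : ℝ in 𝓝 0, fderiv ℝ γ t 1 = frameComb M a₀ (γ t)) {N : ℕ}
    (hclosed : CommutesAtOrder J (frameComb M a) N 0 → ∀ b : Fin N → Bool, ∀ c : Bool,
      nestedLie (List.ofFn fun i => pickVF (frameComb M a) (Jvf J (frameComb M a)) (b i))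
        (pickVF (frameComb M a) (Jvf J (frameComb M a)) c) 0 ∈
          Submodule.span ℝ (Set.range fun i => M i 0))
    (hN : VanishesTo (⊤ : Submodule ℝ F) N fun z => fderiv ℝ γ z 1 - frameComb M a (γ z)) :
    VanishesTo (Submodule.span ℝ (Set.range fun i => M i 0)) N
      fun z => fderiv ℝ γ z 1 - frameComb M a (γ z) := by
  have := FiniteDimensional.complete ℝ F
  set S := Submodule.span ℝ (Set.range fun i => M i 0)
  set Y : Bool → F → F := pickVF (frameComb M a) (Jvf J (frameComb M a)) with hYdef
  have hX : AnalyticAt ℝ (frameComb M a) 0 := .frameComb hM ha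
  have hY : ∀ b, AnalyticAt ℝ (Y b) 0
    | true => hX
    | false => hJ.clm_apply hX
  have hE := analyticAt_tangencyError hγ hγ0 hY
  have hJγ := analyticAt_comp_of_zero hJ hγ hγ0
  have hR := vanishesTo_tangencyError hJ hX hγ hγ0 hol hN
  refine VanishesTo.of_real_axis (hE true) (J 0) hJM ?_ ?_
  · have hofReal : AnalyticAt ℝ (fun t : ℝ => γ t) 0 :=
      hγ.comp_of_eq (Complex.ofRealCLM.analyticAt 0) Complex.ofReal_zero
    have hc {f : F → ℝ} (hf : AnalyticAt ℝ f 0) : AnalyticAt ℝ (fun t : ℝ => f (γ t)) 0 :=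
      hf.comp_of_eq hofReal (by simpa using hγ0)
    have hcM {f : F → F} (hf : AnalyticAt ℝ f 0) : AnalyticAt ℝ (fun t : ℝ => f (γ t)) 0 :=
      hf.comp_of_eq hofReal (by simpa using hγ0)
    have heq : (fun t : ℝ => tangencyError γ Y true t) =ᶠ[𝓝 0]
        fun t : ℝ => ∑ i, (a₀ i (γ t) - a i (γ t)) • M i (γ t) := by
      filter_upwards [hreal] with t ht
      simp only [sub_smul, Finset.sum_sub_distrib]
      simp [tangencyError, axisDir, hYdef, pickVF, frameComb, ht]
    have hv : (fun i => M i (γ ((0 : ℝ) : ℂ))) = fun i => M i 0 := by simp [hγ0]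
    have h := VanishesTo.span_of_sum_smul (u := fun i (t : ℝ) => a₀ i (γ t) - a i (γ t))
      (v := fun i (t : ℝ) => M i (γ t)) (fun i => (hc (ha₀ i)).sub (hc (ha i)))
      (fun i => hcM (hM i)) (hv ▸ hli)
      (((hR true).comp_clm Complex.ofRealCLM (hE true)).congr heq)
    rw [hv] at h
    exact h.congr heq.symm
  · rintro k rfl
    have hcomm : CommutesAtOrder J (frameComb M a) (k + 1) 0 := by
      intro m hm hmk b c
      obtain ⟨m, rfl⟩ := Nat.exists_eq_add_of_le' hm
      rw [List.ofFn_succ]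
      have := nestedLie_eq_zero_of_vanishesTo hγ hγ0 hY hR (b 0) c
        (List.ofFn fun i : Fin m => b i.succ) (by simp; omega)
      simpa [List.map_ofFn, Function.comp_def] using this
    refine vanishesTo_cauchyRiemann hγ hγ0 hY hR (fun l hl c => ?_) (J 0) ?_
    · have hl' : l.map Y = List.ofFn fun i : Fin (k + 1) => Y l[i] :=
        List.ext_getElem (by simp [hl]) fun i _ _ => by
          rw [List.getElem_map, List.getElem_ofFn]
          rfl
      rw [hl']
      exact hclosed hcomm _ c
    · have hd : AnalyticAt ℝ (fun z => J (γ z) - J 0) 0 := hJγ.sub analyticAt_const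
      have h := VanishesTo.clm_apply (a := 1) hd (hE true)
        ⟨by simp [hγ0], fun _ => trivial⟩ (hR true)
      rw [show 1 + (k + 1) = k + 2 by ring] at h
      refine h.congr ?_
      filter_upwards [tangencyError_false (X := frameComb M a) hol] with z hz
      simp [Y, ← hz]

end Frames
section Osculation

open Filter Topology

variable {F : Type*} [NormedAddCommGroup F] [NormedSpace ℝ F] [FiniteDimensional ℝ F]
  {ι : Type*} [Fintype ι] {J : F → F →L[ℝ] F} {M : ι → F → F} {γ : ℂ → F}

theorem exists_frameComb_osculating {U : Set F} (h0U : (0 : F) ∈ U)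
    (hJ : AnalyticAt ℝ J 0) (hM : ∀ i, AnalyticAt ℝ (M i) 0)
    (hli : LinearIndependent ℝ fun i => M i 0)
    (hJM : ∀ x ∈ Submodule.span ℝ (Set.range fun i => M i 0),
      J 0 x ∈ Submodule.span ℝ (Set.range fun i => M i 0))
    (hγ : AnalyticAt ℝ γ 0) (hγ0 : γ 0 = 0)
    (hol : ∀ᶠ z in 𝓝 0, fderiv ℝ γ z Complex.I = J (γ z) (fderiv ℝ γ z 1))
    {a₀ : ι → F → ℝ} (ha₀ : ∀ i, AnalyticOnNhd ℝ (a₀ i) U)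
    (hreal : ∀ᶠ t : ℝ in 𝓝 0, fderiv ℝ γ t 1 = frameComb M a₀ (γ t))
    (hclosed : ∀ a : ι → F → ℝ, (∀ i, AnalyticOnNhd ℝ (a i) U) → ∀ k : ℕ,
      CommutesAtOrder J (frameComb M a) k 0 → ∀ b : Fin k → Bool, ∀ c : Bool,
      nestedLie (List.ofFn fun i => pickVF (frameComb M a) (Jvf J (frameComb M a)) (b i))
        (pickVF (frameComb M a) (Jvf J (frameComb M a)) c) 0 ∈
          Submodule.span ℝ (Set.range fun i => M i 0))
    {Λ : F →L[ℝ] ℂ} (hΛ : VanishesTo (⊤ : Submodule ℝ ℂ) 2 fun z => Λ (γ z) - z) (N : ℕ) :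
    ∃ a : ι → F → ℝ, (∀ i, AnalyticOnNhd ℝ (a i) U) ∧
      VanishesTo (⊤ : Submodule ℝ F) N fun z => fderiv ℝ γ z 1 - frameComb M a (γ z) := by
  have := FiniteDimensional.complete ℝ F
  induction N with
  | zero => exact ⟨a₀, ha₀, trivial⟩
  | succ N ih =>
    obtain ⟨a, ha, hN⟩ := ih
    have hE : AnalyticAt ℝ (fun z => fderiv ℝ γ z 1 - frameComb M a (γ z)) 0 :=
      (hγ.fderiv_apply 1).sub
        (analyticAt_comp_of_zero (.frameComb hM fun i => ha i 0 h0U) hγ hγ0)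
    have hspan := vanishesTo_span_of_commuting hJ hM hli hJM hγ hγ0 hol (fun i => ha₀ i 0 h0U)
      (fun i => ha i 0 h0U) hreal (hclosed a ha N) hN
    obtain ⟨b, hb, hbv, hv⟩ := VanishesTo.exists_leading_combination hγ hΛ _ hE hspan
    have hbγ (i) : AnalyticAt ℝ (fun z => b i (γ z)) 0 := (hb i _).comp hγ
    have hMγ (i) := analyticAt_comp_of_zero (hM i) hγ hγ0
    refine ⟨fun i p => a i p + b i p, fun i p hp => (ha i p hp).add (hb i p), ?_⟩
    refine (hv.sub (hE.sub (Finset.analyticAt_fun_sum _ fun i _ =>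
        (hbγ i).smul analyticAt_const))
      (Finset.analyticAt_fun_sum _ fun i _ => (hbγ i).smul ((hMγ i).sub analyticAt_const))
      (VanishesTo.sum_smul_sub_const hbγ hMγ hbv)).congr (Eventually.of_forall fun z => ?_)
    simp only [frameComb_add, Pi.sub_apply, smul_sub, Finset.sum_sub_distrib, hγ0]
    simp only [frameComb]
    abel

/-- A function vanishing on a regular level set has zero derivative along its tangent directions. -/
theorem fderiv_apply_eq_zero_of_tangent {U : Set F} (hU : IsOpen U) {φ f : F → ℝ} {q v : F}
    (hq : q ∈ U) (hφ : AnalyticAt ℝ φ q) (hf : AnalyticAt ℝ f q) (hφq : φ q = 0)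
    (hdφ : fderiv ℝ φ q ≠ 0) (hfM : ∀ p ∈ U, φ p = 0 → f p = 0) (hv : fderiv ℝ φ q v = 0) :
    fderiv ℝ f q v = 0 := by
  have := FiniteDimensional.complete ℝ F
  have hext : IsLocalExtrOn f {x | φ x = φ q} q := by
    refine Or.inl ?_
    filter_upwards [mem_nhdsWithin_of_mem_nhds (hU.mem_nhds hq), self_mem_nhdsWithin] with p hp hφp
    rw [hfM q hq hφq, hfM p hp (hφp.trans hφq)]
  obtain ⟨a, b, hab, h⟩ := hext.exists_multipliers_of_hasStrictFDerivAt_1d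
    hφ.hasStrictFDerivAt hf.hasStrictFDerivAt
  have hb : b ≠ 0 := by
    rintro rfl
    have ha : a ≠ 0 := fun ha => hab (by simp [ha])
    exact hdφ (by simpa [ha] using h)
  have := DFunLike.congr_fun h v
  simpa [hv, hb] using this

/-- A curve osculating to high order a distribution tangent to `{φ = 0}` annihilates to high order
the functions that vanish on `{φ = 0}`. -/
theorem vanishesTo_comp_of_tangent {U : Set F} (hU : IsOpen U) (h0U : (0 : F) ∈ U) {φ : F → ℝ}
    (hφ : AnalyticOnNhd ℝ φ U) (hφ0 : φ 0 = 0) (hdφ : ∀ q ∈ U, φ q = 0 → fderiv ℝ φ q ≠ 0)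
    (hγ : AnalyticAt ℝ γ 0) (hγ0 : γ 0 = 0) {Y : Bool → F → F} (hY : ∀ b, AnalyticOnNhd ℝ (Y b) U)
    (htan : ∀ b, ∀ q ∈ U, φ q = 0 → fderiv ℝ φ q (Y b q) = 0) {N : ℕ}
    (hR : ∀ b, VanishesTo (⊤ : Submodule ℝ F) N (tangencyError γ Y b)) {m : ℕ} (hm : m ≤ N + 1)
    {f : F → ℝ} (hf : AnalyticOnNhd ℝ f U) (hfM : ∀ p ∈ U, φ p = 0 → f p = 0) :
    VanishesTo (⊤ : Submodule ℝ ℝ) m fun z => f (γ z) := by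
  have := FiniteDimensional.complete ℝ F
  induction m generalizing f with
  | zero => trivial
  | succ m ih =>
    have hf0 := hf 0 h0U
    have hY0 (b) := hY b 0 h0U
    have hd (b : Bool) :
        VanishesTo (⊤ : Submodule ℝ ℝ) m fun z => fderiv ℝ (fun z => f (γ z)) z (axisDir b) := by
      have hg : AnalyticOnNhd ℝ (fun q => fderiv ℝ f q (Y b q)) U := fun q hq =>
        (hf q hq).fderiv.clm_apply (hY b q hq)
      have h1 := ih (by omega) hg fun q hq hφq => fderiv_apply_eq_zero_of_tangent hU hq (hφ q hq)
        (hf q hq) hφq (hdφ q hq hφq) hfM (htan b q hq hφq)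
      have hE := analyticAt_tangencyError hγ hγ0 hY0 b
      have h2 := (vanishesTo_fderiv_comp_apply hf0 hγ hγ0 hE (hR b)).of_le (m := m) (by omega)
      refine (h1.add (analyticAt_comp_of_zero (hg 0 h0U) hγ hγ0)
        ((analyticAt_comp_of_zero hf0.fderiv hγ hγ0).clm_apply hE) h2).congr ?_
      filter_upwards [fderiv_comp_eventuallyEq hf0 hγ hγ0 (axisDir b)] with z hz
      simp [hz, tangencyError]
    exact VanishesTo.of_partial (analyticAt_comp_of_zero hf0 hγ hγ0) (by simp [hγ0, hfM 0 h0U hφ0])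
      (hd true) (hd false)

end Osculation
section Curves

open Filter Topology

variable {F : Type*} [NormedAddCommGroup F] [NormedSpace ℝ F] {J : F → F →L[ℝ] F} {X : F → F}
  {γ : ℂ → F}

theorem Complex.clm_apply_I_mul {T : ℂ →L[ℝ] F} {A : F →L[ℝ] F}
    (hA : A.comp A = -ContinuousLinearMap.id ℝ F) (hT : T Complex.I = A (T 1)) (v : ℂ) :
    T (Complex.I * v) = A (T v) := by
  have h : A (A (T 1)) = -T 1 := DFunLike.congr_fun hA (T 1)
  rw [Complex.clm_apply_eq_partials T v, Complex.clm_apply_eq_partials T (Complex.I * v), hT]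
  simp [h, add_comm]

theorem AnalyticAt.DX [CompleteSpace F] {p : F} (hX : AnalyticAt ℝ X p) (k : ℕ) :
    AnalyticAt ℝ (DX X X k) p := by
  induction k with
  | zero => exact hX
  | succ k ih => exact ih.fderiv.clm_apply hX

theorem DX_eq_zero {p : F} (hX : X p = 0) (k : ℕ) : DX X X k p = 0 := by
  cases k with
  | zero => exact hX
  | succ k => simp [DX, derVF, hX]

/-- The derivatives of an integral curve of `X` are the iterated flat covariant derivatives. -/
theorem iteratedDeriv_eventuallyEq_DX [CompleteSpace F] (hX : AnalyticAt ℝ X 0)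
    (hγ : AnalyticAt ℝ γ 0) (hγ0 : γ 0 = 0)
    (hreal : ∀ᶠ t : ℝ in 𝓝 0, fderiv ℝ γ t 1 = X (γ t)) (k : ℕ) :
    iteratedDeriv (k + 1) (fun t : ℝ => γ t) =ᶠ[𝓝 0] fun t : ℝ => DX X X k (γ t) := by
  have hofReal : Tendsto (fun t : ℝ => (t : ℂ)) (𝓝 0) (𝓝 0) :=
    Complex.continuous_ofReal.tendsto' _ _ Complex.ofReal_zero
  have hderiv {g : ℂ → F} (hg : AnalyticAt ℝ g 0) :
      deriv (fun t : ℝ => g t) =ᶠ[𝓝 0] fun t : ℝ => fderiv ℝ g t 1 := by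
    filter_upwards [hofReal.eventually hg.eventually_differentiableAt] with t ht
    exact (ht.hasFDerivAt.comp_hasDerivAt t Complex.ofRealCLM.hasDerivAt).deriv.trans (by simp)
  induction k with
  | zero =>
    rw [zero_add, iteratedDeriv_one]
    exact (hderiv hγ).trans hreal
  | succ k ih =>
    rw [iteratedDeriv_succ]
    refine ih.deriv.trans ?_
    filter_upwards [hderiv (analyticAt_comp_of_zero (hX.DX k) hγ hγ0), hreal,
      hofReal.eventually (fderiv_comp_eventuallyEq (hX.DX k) hγ hγ0 1)] with t h1 h2 h3
    rw [h1, h3, h2]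
    rfl

theorem vanishesTo_two_of_fderiv [CompleteSpace F] (hγ : AnalyticAt ℝ γ 0) (hγ0 : γ 0 = 0)
    {Λ : F →L[ℝ] ℂ} (h1 : Λ (fderiv ℝ γ 0 1) = 1) (hI : Λ (fderiv ℝ γ 0 Complex.I) = Complex.I) :
    VanishesTo (⊤ : Submodule ℝ ℂ) 2 fun z => Λ (γ z) - z := by
  have h : fderiv ℝ (fun z => Λ (γ z) - z) 0 = Λ.comp (fderiv ℝ γ 0) - .id ℝ ℂ :=
    ((Λ.hasFDerivAt.comp 0 hγ.differentiableAt.hasFDerivAt).sub (hasFDerivAt_id 0)).fderiv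
  refine ⟨by simp [hγ0], fun v => ⟨?_, fun _ => trivial⟩⟩
  have hv := Complex.clm_apply_eq_partials (Λ.comp (fderiv ℝ γ 0)) v
  simp only [ContinuousLinearMap.comp_apply, h1, hI] at hv
  simp [h, hv]

theorem exists_clm_eq_one {E : Type*} [NormedAddCommGroup E] [InnerProductSpace ℂ E] {x : E}
    (hx : x ≠ 0) : ∃ Λ : E →L[ℂ] ℂ, Λ x = 1 :=
  ⟨((‖x‖ : ℂ) ^ 2)⁻¹ • innerSL ℂ x, by
    have : (‖x‖ : ℂ) ^ 2 ≠ 0 := by simpa using hx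
    simp [inner_self_eq_norm_sq_to_K, this]⟩

end Curves

section Subbundle

open Filter Topology

variable {n ℓ : ℕ} {J : Ecx n → Ecx n →L[ℝ] Ecx n} {L : Fin ℓ → Ecx n → Ecx n}

/-- The real frame `L₁, …, L_ℓ, JL₁, …, JL_ℓ` of the subbundle. -/
def realFrame (J : Ecx n → Ecx n →L[ℝ] Ecx n) (L : Fin ℓ → Ecx n → Ecx n) :
    Fin ℓ ⊕ Fin ℓ → Ecx n → Ecx n :=
  Sum.elim L fun i => Jvf J (L i)

theorem frameComb_realFrame (a : Fin ℓ ⊕ Fin ℓ → Ecx n → ℝ) (p : Ecx n) :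
    frameComb (realFrame J L) a p =
      ∑ i, (a (.inl i) p • L i p + a (.inr i) p • J p (L i p)) := by
  simp [frameComb, realFrame, Jvf, Fintype.sum_sum_type, Finset.sum_add_distrib]

theorem isSection_frameComb {U : Set (Ecx n)} {a : Fin ℓ ⊕ Fin ℓ → Ecx n → ℝ}
    (ha : ∀ i, AnalyticOnNhd ℝ (a i) U) : IsSection J U L (frameComb (realFrame J L) a) :=
  ⟨fun i => a (.inl i), fun i => a (.inr i), fun _ => ⟨ha _, ha _⟩,
    fun p _ => frameComb_realFrame a p⟩

theorem IsSection.exists_eqOn_frameComb {U : Set (Ecx n)} {X : Ecx n → Ecx n}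
    (hX : IsSection J U L X) : ∃ a : Fin ℓ ⊕ Fin ℓ → Ecx n → ℝ,
      (∀ i, AnalyticOnNhd ℝ (a i) U) ∧ U.EqOn X (frameComb (realFrame J L) a) := by
  obtain ⟨a, b, hab, h⟩ := hX
  refine ⟨Sum.elim a b, ?_, fun p hp => by rw [frameComb_realFrame, h p hp]; rfl⟩
  rintro (i | i)
  exacts [(hab i).1, (hab i).2]

theorem span_realFrame :
    Submodule.span ℝ (Set.range fun i => realFrame J L i 0) = L0span J L := by
  rw [L0span]
  congr 1
  ext x
  simp [realFrame, Jvf]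

theorem map_span_realFrame_subset {q : Ecx n}
    (hJ : (J q).comp (J q) = -ContinuousLinearMap.id ℝ (Ecx n)) {x : Ecx n}
    (hx : x ∈ Submodule.span ℝ (Set.range fun i => realFrame J L i q)) :
    J q x ∈ Submodule.span ℝ (Set.range fun i => realFrame J L i q) := by
  suffices h : Submodule.span ℝ (Set.range fun i => realFrame J L i q) ≤
      (Submodule.span ℝ (Set.range fun i => realFrame J L i q)).comap (J q).toLinearMap from h hx
  rw [Submodule.span_le]
  rintro _ ⟨i | i, rfl⟩
  · exact Submodule.subset_span ⟨.inr i, rfl⟩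
  · have h : J q (J q (L i q)) = -L i q := DFunLike.congr_fun hJ _
    change J q (J q (L i q)) ∈ Submodule.span ℝ (Set.range fun i => realFrame J L i q)
    rw [h]
    exact Submodule.neg_mem _ (Submodule.subset_span ⟨.inl i, rfl⟩)

theorem frameComb_mem_span {F ι : Type*} [NormedAddCommGroup F] [NormedSpace ℝ F] [Fintype ι]
    (M : ι → F → F) (a : ι → F → ℝ) (q : F) :
    frameComb M a q ∈ Submodule.span ℝ (Set.range fun i => M i q) :=
  Submodule.sum_mem _ fun i _ => Submodule.smul_mem _ _ (Submodule.subset_span ⟨i, rfl⟩)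

theorem fderiv_eq_zero_of_mem_span_realFrame {U : Set (Ecx n)} {φ : Ecx n → ℝ}
    (hL : ∀ i, InTJM J φ U (L i)) {q : Ecx n} (hq : q ∈ U) (hφq : φ q = 0) {x : Ecx n}
    (hx : x ∈ Submodule.span ℝ (Set.range fun i => realFrame J L i q)) :
    fderiv ℝ φ q x = 0 := by
  suffices h : Submodule.span ℝ (Set.range fun i => realFrame J L i q) ≤
      LinearMap.ker (fderiv ℝ φ q).toLinearMap from h hx
  rw [Submodule.span_le]
  rintro _ ⟨i | i, rfl⟩
  exacts [(hL i q hq hφq).1, (hL i q hq hφq).2]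

end Subbundle

/-- Theorem 1.4, `subbundle`. -/
theorem stmt3 (n : ℕ) (U : Set (Ecx n)) (hU : IsOpen U) (h0U : (0 : Ecx n) ∈ U)
    (J : Ecx n → Ecx n →L[ℝ] Ecx n) (hJan : AnalyticOnNhd ℝ J U)
    (hJsq : ∀ x ∈ U, (J x).comp (J x) = -ContinuousLinearMap.id ℝ (Ecx n))
    (hJ0 : J 0 = J0 n)
    (φ : Ecx n → ℝ) (hφan : AnalyticOnNhd ℝ φ U) (hφ0 : φ 0 = 0)
    (hdφ : ∀ q ∈ U, φ q = 0 → fderiv ℝ φ q ≠ 0)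
    (ℓ : ℕ) (L : Fin ℓ → Ecx n → Ecx n)
    (hLan : ∀ i, AnalyticOnNhd ℝ (L i) U)
    (hLtan : ∀ i, InTJM J φ U (L i))
    (hLindep : ∀ q ∈ U, LinearIndependent ℝ
      (Sum.elim (fun i : Fin ℓ => L i q) (fun i : Fin ℓ => J q (L i q))))
    (hclosed : ∀ X : Ecx n → Ecx n, IsSection J U L X → ∀ k : ℕ,
      CommutesAtOrder J X k 0 →
      ∀ b : Fin k → Bool, ∀ c : Bool,
        nestedLie (List.ofFn fun i => pickVF X (Jvf J X) (b i)) (pickVF X (Jvf J X) c) 0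
          ∈ L0span J L) :
    ∀ X : Ecx n → Ecx n, IsSection J U L X →
      ∃ ρ > (0 : ℝ), ∃ γ : ℂ → Ecx n,
        AnalyticOnNhd ℝ γ (ball 0 ρ) ∧
        JHolOn J (ball 0 ρ) γ ∧
        γ 0 = 0 ∧
        (∀ ζ ∈ ball (0 : ℂ) ρ, γ ζ ∈ U ∧ φ (γ ζ) = 0) ∧
        ∀ k : ℕ, 1 ≤ k → iteratedDeriv k (fun t : ℝ => γ t) 0 = DX X X (k - 1) 0 := by
  intro X hX
  by_cases hX0 : X 0 = 0
  · refine ⟨1, one_pos, fun _ => 0, fun _ _ => analyticAt_const, fun ζ _ v => by simp, rfl,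
      fun _ _ => ⟨h0U, hφ0⟩, fun k hk => ?_⟩
    rw [DX_eq_zero hX0, iteratedDeriv_const, if_neg (by omega)]
  have hMan (i) : AnalyticOnNhd ℝ (realFrame J L i) U := by
    rcases i with i | i
    exacts [hLan i, fun p hp => (hJan p hp).clm_apply (hLan i p hp)]
  have hMan0 (i) := hMan i 0 h0U
  have hJan0 := hJan 0 h0U
  have hli : LinearIndependent ℝ fun i => realFrame J L i 0 := by
    convert hLindep 0 h0U using 1
    ext1 (i | i) <;> rfl
  obtain ⟨a₀, ha₀, hXa₀⟩ := hX.exists_eqOn_frameComb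
  have hUnhds := hU.mem_nhds h0U
  have hXan : AnalyticAt ℝ X 0 := (AnalyticAt.frameComb hMan0 fun i => ha₀ i 0 h0U).congr
    (hXa₀.symm.eventuallyEq_of_mem hUnhds)
  obtain ⟨γ, hγ, hγ0, hol, hreal⟩ := exists_pseudoholomorphic_germ hJan0 hXan
  have hγU : ∀ᶠ z in nhds 0, γ z ∈ U := eventually_comp_of_zero hUnhds hγ hγ0
  have hofReal : Filter.Tendsto (fun t : ℝ => (t : ℂ)) (nhds 0) (nhds 0) :=
    Complex.continuous_ofReal.tendsto' _ _ Complex.ofReal_zero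
  have hdγ1 : fderiv ℝ γ 0 1 = X 0 := by simpa [hγ0] using hreal.self_of_nhds
  have hdγI : fderiv ℝ γ 0 Complex.I = Complex.I • X 0 := by
    rw [hol.self_of_nhds, hdγ1, hγ0, hJ0]
    rfl
  obtain ⟨Λ, hΛ⟩ := exists_clm_eq_one hX0
  have hΛγ := vanishesTo_two_of_fderiv hγ hγ0 (Λ := Λ.restrictScalars ℝ) (by simp [hdγ1, hΛ])
    (by simp [hdγI, hΛ])
  have hφγ : (fun z => φ (γ z)) =ᶠ[nhds 0] 0 := by
    refine VanishesTo.eventually_eq_zero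
      (analyticAt_comp_of_zero (hφan 0 h0U) hγ hγ0) fun m => ?_
    obtain ⟨a, ha, hE⟩ := exists_frameComb_osculating h0U hJan0 hMan0 hli
      (fun x => map_span_realFrame_subset (hJsq 0 h0U)) hγ hγ0 hol ha₀
      (by filter_upwards [hreal, hofReal.eventually hγU] with t ht htU using ht.trans (hXa₀ htU))
      (fun a ha k => by
        rw [span_realFrame]
        exact hclosed _ (isSection_frameComb ha) k) hΛγ m
    have hXm : AnalyticOnNhd ℝ (frameComb (realFrame J L) a) U := fun p hp =>
      .frameComb (fun i => hMan i p hp) fun i => ha i p hp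
    refine vanishesTo_comp_of_tangent hU h0U hφan hφ0 hdφ hγ hγ0 (fun b => ?_)
      (fun b q hq hφq => fderiv_eq_zero_of_mem_span_realFrame hLtan hq hφq ?_)
      (vanishesTo_tangencyError hJan0 (hXm 0 h0U) hγ hγ0 hol hE) m.le_succ hφan fun _ _ h => h
    · cases b
      exacts [fun p hp => (hJan p hp).clm_apply (hXm p hp), hXm]
    · cases b
      exacts [map_span_realFrame_subset (hJsq q hq) (frameComb_mem_span _ a q),
        frameComb_mem_span _ a q]
  obtain ⟨ρ, hρ, hball⟩ := Metric.eventually_nhds_iff_ball.1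
    (hγ.eventually_analyticAt.and (hol.and (hγU.and hφγ)))
  refine ⟨ρ, hρ, γ, fun z hz => (hball z hz).1, fun z hz =>
    Complex.clm_apply_I_mul (hJsq _ (hball z hz).2.2.1) (hball z hz).2.1, hγ0,
    fun z hz => (hball z hz).2.2, fun k hk => ?_⟩
  obtain ⟨k, rfl⟩ := Nat.exists_eq_add_of_le' hk
  simpa [hγ0] using (iteratedDeriv_eventuallyEq_DX hXan hγ hγ0 hreal k).self_of_nhds
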